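/- Let Λ be a simple gluing algebra of finite-dimensional bound quiver algebras A and B. Then Λ is Iwanaga-Gorenstein if and only if both A and B are Iwanaga-Gorenstein. Moreover, in that case max{Gd A, Gd B} ≤ Gd Λ ≤ max{Gd A, Gd B, 1}. -/

import Mathlib

set_option maxHeartbeats 1000000
set_option synthInstance.maxHeartbeats 400000

open CategoryTheory


/-- A finite quiver: finite sets of vertices and of arrows, with source and target maps. -/
structure BQuiver : Type 1 where
  V : Type
  Arr : Type
  fV : Fintype V
  dV : DecidableEq V
  fA : Fintype Arr
  s : Arr → V
  t : Arr → V

attribute [instance] BQuiver.fV BQuiver.dV BQuiver.fA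

instance BQuiver.quiver (Q : BQuiver) : Quiver Q.V :=
  ⟨fun i j => {e : Q.Arr // Q.s e = i ∧ Q.t e = j}⟩

/-- The index set of paths of a quiver. -/
def PIdx (Q : BQuiver) : Type := Σ i j : Q.V, Quiver.Path i j

/-- The underlying vector space of the path algebra: the free `K`-module on the set of paths. -/
def PMod (K : Type) [Field K] (Q : BQuiver) : Type := PIdx Q →₀ K

noncomputable instance (K : Type) [Field K] (Q : BQuiver) : AddCommGroup (PMod K Q) :=
  inferInstanceAs (AddCommGroup (PIdx Q →₀ K))

noncomputable instance (K : Type) [Field K] (Q : BQuiver) : Module K (PMod K Q) :=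
  inferInstanceAs (Module K (PIdx Q →₀ K))

/-- The operator of left multiplication by a path `p`, acting on the free module on paths:
a basis path `q` is sent to the concatenation `q.comp p` when composable and to `0`
otherwise. -/
noncomputable def Lop (K : Type) [Field K] (Q : BQuiver) {i j : Q.V} (p : Quiver.Path i j) :
    Module.End K (PMod K Q) :=
  Finsupp.lsum K fun q : PIdx Q =>
    if h : q.2.1 = i then Finsupp.lsingle (⟨q.1, j, (h ▸ q.2.2).comp p⟩ : PIdx Q) else 0

/-- The path algebra `KQ`, realized via the faithful left regular representation as the
subalgebra of `End_K(K^{(paths)})` generated by the left multiplication operators by paths. -/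
noncomputable def PathAlg (K : Type) [Field K] (Q : BQuiver) :
    Subalgebra K (Module.End K (PMod K Q)) :=
  Algebra.adjoin K {f | ∃ (i j : Q.V) (p : Quiver.Path i j), f = Lop K Q p}

/-- The element of the path algebra corresponding to a path. -/
noncomputable def pathEl (K : Type) [Field K] (Q : BQuiver) {i j : Q.V}
    (p : Quiver.Path i j) : PathAlg K Q :=
  ⟨Lop K Q p, Algebra.subset_adjoin ⟨i, j, p, rfl⟩⟩
/-- Evaluation of a formal linear combination of paths as an endomorphism. -/
noncomputable def evalEnd (K : Type) [Field K] (Q : BQuiver) : (PIdx Q →₀ K) →ₗ[K] Module.End K (PMod K Q) :=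
  Finsupp.lsum K fun q : PIdx Q => LinearMap.toSpanSingleton K _ (Lop K Q q.2.2)

/-- Evaluation of a formal linear combination of paths as an element of the path algebra. -/
noncomputable def evalPA (K : Type) [Field K] (Q : BQuiver) (x : PIdx Q →₀ K) : PathAlg K Q :=
  ⟨evalEnd K Q x, by
    classical
    have : evalEnd K Q x = ∑ q ∈ x.support, x q • Lop K Q q.2.2 := by
      simp [evalEnd, Finsupp.lsum_apply, Finsupp.sum, LinearMap.toSpanSingleton_apply]
    rw [this]
    exact Submodule.sum_mem (Subalgebra.toSubmodule (PathAlg K Q)) fun q _ =>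
      Submodule.smul_mem _ _ (Algebra.subset_adjoin ⟨q.1, q.2.1, q.2.2, rfl⟩)⟩
section Glue

variable (QA QB : BQuiver) (a : QA.V) (b : QB.V)

/-- The vertex map from `Q_B` to the glued quiver: `b` is identified with `a`. -/
def vmapB : QB.V → (QA.V ⊕ {x : QB.V // x ≠ b}) := fun x =>
  if h : x = b then Sum.inl a else Sum.inr ⟨x, h⟩

/-- The simple gluing quiver of `Q_A` and `Q_B`, obtained by identifying the vertices
`a ∈ Q_A` and `b ∈ Q_B`. -/
def glueQ : BQuiver where
  V := QA.V ⊕ {x : QB.V // x ≠ b}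
  Arr := QA.Arr ⊕ QB.Arr
  fV := by infer_instance
  dV := by infer_instance
  fA := by infer_instance
  s := Sum.elim (fun e => Sum.inl (QA.s e)) (fun e => vmapB QA QB a b (QB.s e))
  t := Sum.elim (fun e => Sum.inl (QA.t e)) (fun e => vmapB QA QB a b (QB.t e))

/-- The glued vertex of the simple gluing quiver. -/
def gluedV : (glueQ QA QB a b).V := Sum.inl a

/-- The embedding of `Q_A` into the glued quiver, as a prefunctor. -/
def embA : QA.V ⥤q (glueQ QA QB a b).V where
  obj := Sum.inl
  map := fun {i j} e => ⟨Sum.inl e.1, congrArg Sum.inl e.2.1, congrArg Sum.inl e.2.2⟩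

/-- The embedding of `Q_B` into the glued quiver, as a prefunctor. -/
def embB : QB.V ⥤q (glueQ QA QB a b).V where
  obj := vmapB QA QB a b
  map := fun {i j} e => ⟨Sum.inr e.1, congrArg (vmapB QA QB a b) e.2.1,
    congrArg (vmapB QA QB a b) e.2.2⟩

variable (K : Type) [Field K]

/-- The map sending a formal linear combination of paths of `Q_A` to the corresponding
formal linear combination of paths of the glued quiver. -/
noncomputable def liftA : (PIdx QA →₀ K) → (PIdx (glueQ QA QB a b) →₀ K) :=
  Finsupp.mapDomain fun q =>
    ⟨Sum.inl q.1, Sum.inl q.2.1, (embA QA QB a b).mapPath q.2.2⟩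

/-- The map sending a formal linear combination of paths of `Q_B` to the corresponding
formal linear combination of paths of the glued quiver. -/
noncomputable def liftB : (PIdx QB →₀ K) → (PIdx (glueQ QA QB a b) →₀ K) :=
  Finsupp.mapDomain fun q =>
    ⟨vmapB QA QB a b q.1, vmapB QA QB a b q.2.1, (embB QA QB a b).mapPath q.2.2⟩

end Glue
section Ideals

variable (K : Type) [Field K] (Q : BQuiver)

/-- The two-sided ideal of the path algebra generated by a set of relations
(formal linear combinations of paths). -/
noncomputable def relIdeal (R : Set (PIdx Q →₀ K)) : TwoSidedIdeal (PathAlg K Q) :=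
  TwoSidedIdeal.span (evalPA K Q '' R)

/-- The bound quiver algebra `KQ/I`, as the quotient ring of the path algebra by a two-sided
ideal. -/
def BQAlg (I : TwoSidedIdeal (PathAlg K Q)) : Type := I.ringCon.Quotient

noncomputable instance (I : TwoSidedIdeal (PathAlg K Q)) : Ring (BQAlg K Q I) :=
  inferInstanceAs (Ring I.ringCon.Quotient)

/-- The quotient map from the path algebra onto the bound quiver algebra. -/
noncomputable def BQmk (I : TwoSidedIdeal (PathAlg K Q)) : PathAlg K Q →+* BQAlg K Q I :=
  I.ringCon.mk'

/-- The quotient of the path algebra by (the underlying `K`-subspace of) a two-sided ideal,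
as a `K`-vector space; it is `K`-linearly isomorphic to the bound quiver algebra, and is used
to express finite-dimensionality over `K`. -/
def BQAlgModK (I : TwoSidedIdeal (PathAlg K Q)) : Type :=
  (PathAlg K Q) ⧸ (Submodule.restrictScalars K (TwoSidedIdeal.asIdeal I))

noncomputable instance (I : TwoSidedIdeal (PathAlg K Q)) : AddCommGroup (BQAlgModK K Q I) :=
  inferInstanceAs (AddCommGroup ((PathAlg K Q) ⧸ (Submodule.restrictScalars K (TwoSidedIdeal.asIdeal I))))

noncomputable instance (I : TwoSidedIdeal (PathAlg K Q)) : Module K (BQAlgModK K Q I) :=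
  inferInstanceAs (Module K ((PathAlg K Q) ⧸ (Submodule.restrictScalars K (TwoSidedIdeal.asIdeal I))))

/-- An ideal of the path algebra is admissible: it contains all paths of some length `N`,
and is contained in the span of the paths of length at least `2`. -/
def IsAdmissible (I : TwoSidedIdeal (PathAlg K Q)) : Prop :=
  (∃ N : ℕ, ∀ (i j : Q.V) (p : Quiver.Path i j), N ≤ p.length → pathEl K Q p ∈ I) ∧
    (∀ x ∈ I, (x : Module.End K (PMod K Q)) ∈
      Submodule.span K {f | ∃ (i j : Q.V) (p : Quiver.Path i j),
        2 ≤ p.length ∧ f = Lop K Q p})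

end Ideals
section GlueAlg

variable (QA QB : BQuiver) (a : QA.V) (b : QB.V) (K : Type) [Field K]

/-- The defining ideal of the simple gluing algebra: the two-sided ideal generated by the
relations of `A` and the relations of `B`, viewed in the path algebra of the glued quiver. -/
noncomputable def glueIdeal (RA : Set (PIdx QA →₀ K)) (RB : Set (PIdx QB →₀ K)) :
    TwoSidedIdeal (PathAlg K (glueQ QA QB a b)) :=
  relIdeal K (glueQ QA QB a b) (liftA QA QB a b K '' RA ∪ liftB QA QB a b K '' RB)

/-- The bound quiver algebra `A = KQ_A/I_A`. -/
noncomputable abbrev ARing (RA : Set (PIdx QA →₀ K)) : Type :=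
  BQAlg K QA (relIdeal K QA RA)

/-- The simple gluing algebra `Λ = KQ/⟨I_A, I_B⟩`. -/
noncomputable abbrev LRing (RA : Set (PIdx QA →₀ K)) (RB : Set (PIdx QB →₀ K)) : Type :=
  BQAlg K (glueQ QA QB a b) (glueIdeal QA QB a b K RA RB)

variable (RA : Set (PIdx QA →₀ K)) (RB : Set (PIdx QB →₀ K))

/-- The idempotent `e_v` of `Λ` at a vertex `v` of the glued quiver. -/
noncomputable def eVert (v : (glueQ QA QB a b).V) : LRing QA QB a b K RA RB :=
  BQmk K _ _ (pathEl K (glueQ QA QB a b) (Quiver.Path.nil : Quiver.Path v v))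

/-- The idempotent `e_A = ∑_{i ∈ Q_A} e_i` of `Λ`. -/
noncomputable def glueEA : LRing QA QB a b K RA RB :=
  ∑ i : QA.V, eVert QA QB a b K RA RB ((embA QA QB a b).obj i)

/-- The idempotent `e_B = ∑_{i ∈ Q_B} e_i` of `Λ`. -/
noncomputable def glueEB : LRing QA QB a b K RA RB :=
  ∑ i : QB.V, eVert QA QB a b K RA RB ((embB QA QB a b).obj i)

/-- The indecomposable projective `Λ`-module `U(v) = Λ e_v` at the glued vertex. -/
noncomputable def projUv : Submodule (LRing QA QB a b K RA RB) (LRing QA QB a b K RA RB) :=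
  LinearMap.range (LinearMap.toSpanSingleton (LRing QA QB a b K RA RB)
    (LRing QA QB a b K RA RB) (eVert QA QB a b K RA RB (gluedV QA QB a b)))

end GlueAlg

/-- The additive subgroup `e•M` of an `R`-module `M` determined by an idempotent `e`,
given by the fixed points of the action of `e`. -/
def cornerSub (R : Type) [Ring R] (e : R) (M : Type) [AddCommGroup M] [Module R M] :
    AddSubgroup M where
  carrier := {m | e • m = m}
  add_mem' := fun {x y} hx hy => by
    simp only [Set.mem_setOf_eq, smul_add] at *
    rw [hx, hy]
  zero_mem' := smul_zero e
  neg_mem' := fun {x} hx => by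
    simp only [Set.mem_setOf_eq, smul_neg] at *
    rw [hx]
structure GlueData (K : Type) [Field K] : Type 1 where
  QA : BQuiver
  QB : BQuiver
  a : QA.V
  b : QB.V
  RA : Set (PIdx QA →₀ K)
  RB : Set (PIdx QB →₀ K)
  admA : IsAdmissible K QA (relIdeal K QA RA)
  admB : IsAdmissible K QB (relIdeal K QB RB)
  fdA : FiniteDimensional K (BQAlgModK K QA (relIdeal K QA RA))
  fdB : FiniteDimensional K (BQAlgModK K QB (relIdeal K QB RB))
  cyclesA : ∀ p : Quiver.Path a a, p ≠ Quiver.Path.nil → pathEl K QA p ∈ relIdeal K QA RA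

/-- `HasInjDimLE A n M` means that `M` has injective dimension at most `n`. -/
def HasInjDimLE (A : Type) [Ring A] : ℕ → ∀ (M : Type) [AddCommGroup M] [Module A M], Prop
  | 0 => fun M _ _ => Module.Injective A M
  | n + 1 => fun M _ _ => ∃ (I : Type) (_ : AddCommGroup I) (_ : Module A I),
      Module.Injective A I ∧ ∃ f : M →ₗ[A] I, Function.Injective f ∧
        HasInjDimLE A n (I ⧸ LinearMap.range f)

/-- An algebra is Iwanaga-Gorenstein if it has finite self-injective dimension
on both sides (right modules being modules over `Aᵐᵒᵖ`). -/
def IwanagaGorenstein (A : Type) [Ring A] : Prop :=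
  (∃ n, HasInjDimLE A n A) ∧ (∃ n, HasInjDimLE Aᵐᵒᵖ n Aᵐᵒᵖ)

/-- The Gorenstein dimension of an Iwanaga-Gorenstein algebra: the smallest `d` bounding the
self-injective dimension on both sides. -/
noncomputable def gorensteinDim (A : Type) [Ring A] : ℕ :=
  sInf {d | HasInjDimLE A d A ∧ HasInjDimLE Aᵐᵒᵖ d Aᵐᵒᵖ}

open CategoryTheory

section InjDim

variable {R : Type} [Ring R]

theorem idim_catses {M I C : Type} [AddCommGroup M] [Module R M] [AddCommGroup I] [Module R I]
    [AddCommGroup C] [Module R C] (f : M →ₗ[R] I) (g : I →ₗ[R] C)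
    (hf : Function.Injective f) (hg : Function.Surjective g) (hfg : Function.Exact f g)
    (hI : Module.Injective R I) (n : ℕ) :
    HasInjectiveDimensionLT (ModuleCat.of R C) (n + 1) ↔
      HasInjectiveDimensionLT (ModuleCat.of R M) (n + 2) := by
  have h0 : ModuleCat.ofHom f ≫ ModuleCat.ofHom g = 0 := by
    ext x
    simpa using hfg.apply_apply_eq_zero x
  let S : ShortComplex (ModuleCat.{0} R) := ShortComplex.mk (ModuleCat.ofHom f) (ModuleCat.ofHom g) h0
  have hS : S.ShortExact :=
    { exact := (ShortComplex.ShortExact.moduleCat_exact_iff_function_exact _).mpr hfg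
      mono_f := (ModuleCat.mono_iff_injective _).mpr hf
      epi_g := (ModuleCat.epi_iff_surjective _).mpr hg }
  exact hS.hasInjectiveDimensionLT_X₃_iff n ((Module.injective_iff_injective_object R I).mp hI)

theorem idim_exists_inj (M : Type) [AddCommGroup M] [Module R M] :
    ∃ (I : Type) (_ : AddCommGroup I) (_ : Module R I), Module.Injective R I ∧
      ∃ f : M →ₗ[R] I, Function.Injective f := by
  obtain ⟨⟨J, hJ, f, hf⟩⟩ := EnoughInjectives.presentation (ModuleCat.of R M)
  refine ⟨J, inferInstance, inferInstance, (Module.injective_iff_injective_object R J).mpr hJ,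
    f.hom, (ModuleCat.mono_iff_injective _).mp hf⟩

theorem idim_iff (n : ℕ) : ∀ (M : Type) [AddCommGroup M] [Module R M],
    HasInjDimLE R n M ↔ HasInjectiveDimensionLT (ModuleCat.of R M) (n + 1) := by
  induction n with
  | zero =>
    intro M _ _
    rw [← injective_iff_hasInjectiveDimensionLT_one, ← Module.injective_iff_injective_object]
    rfl
  | succ n ih =>
    intro M _ _
    constructor
    · rintro ⟨I, _, _, hI, f, hf, h⟩
      rw [ih] at h
      exact (idim_catses f (LinearMap.range f).mkQ hf (Submodule.mkQ_surjective _)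
        (LinearMap.exact_map_mkQ_range f) hI n).mp h
    · intro h
      obtain ⟨I, _, _, hI, f, hf⟩ := idim_exists_inj (R := R) M
      refine ⟨I, _, _, hI, f, hf, ?_⟩
      rw [ih]
      exact (idim_catses f (LinearMap.range f).mkQ hf (Submodule.mkQ_surjective _)
        (LinearMap.exact_map_mkQ_range f) hI n).mpr h

theorem idim_ses {M I C : Type} [AddCommGroup M] [Module R M] [AddCommGroup I] [Module R I]
    [AddCommGroup C] [Module R C] (f : M →ₗ[R] I) (g : I →ₗ[R] C)
    (hf : Function.Injective f) (hg : Function.Surjective g) (hfg : Function.Exact f g)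
    (hI : Module.Injective R I) (n : ℕ) :
    HasInjDimLE R n C ↔ HasInjDimLE R (n + 1) M := by
  rw [idim_iff, idim_iff]
  exact idim_catses f g hf hg hfg hI n

theorem idim_mono {M : Type} [AddCommGroup M] [Module R M] {n m : ℕ} (hnm : n ≤ m)
    (h : HasInjDimLE R n M) : HasInjDimLE R m M := by
  rw [idim_iff] at *
  exact hasInjectiveDimensionLT_of_ge _ (n + 1) (m + 1) (by omega)

theorem idim_retract {M N : Type} [AddCommGroup M] [Module R M] [AddCommGroup N] [Module R N]
    (i : N →ₗ[R] M) (r : M →ₗ[R] N) (hr : ∀ x, r (i x) = x) {n : ℕ}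
    (h : HasInjDimLE R n M) : HasInjDimLE R n N := by
  rw [idim_iff] at *
  have e : Retract (ModuleCat.of R N) (ModuleCat.of R M) :=
    { i := ModuleCat.ofHom i, r := ModuleCat.ofHom r, retract := by ext x; simpa using hr x }
  exact e.hasInjectiveDimensionLT (n + 1)

theorem idim_pi {ι : Type} (n : ℕ) : ∀ (M : Type) [AddCommGroup M] [Module R M],
    HasInjDimLE R n M → HasInjDimLE R n (ι → M) := by
  induction n with
  | zero =>
    intro M _ _ h
    have : Module.Injective R M := h
    exact (inferInstance : Module.Injective R (ι → M))
  | succ n ih =>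
    rintro M _ _ ⟨I, _, _, hI, f, hf, h⟩
    have h2 := ih _ h
    refine (idim_ses (f.compLeft ι) ((LinearMap.range f).mkQ.compLeft ι) ?_ ?_ ?_
      inferInstance n).mp h2
    · intro x y hxy
      funext i
      exact hf (congrFun hxy i)
    · intro y
      choose x hx using fun i => Submodule.mkQ_surjective (LinearMap.range f) (y i)
      exact ⟨x, funext hx⟩
    · intro y
      have hex := LinearMap.exact_map_mkQ_range f
      constructor
      · intro hy
        choose x hx using fun i => (hex (y i)).mp (congrFun hy i)
        exact ⟨x, funext hx⟩
      · rintro ⟨x, rfl⟩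
        funext i
        exact hex.apply_apply_eq_zero (x i)

theorem inj_of_retract {M N : Type} [AddCommGroup M] [Module R M] [AddCommGroup N] [Module R N]
    (i : N →ₗ[R] M) (r : M →ₗ[R] N) (hr : ∀ x, r (i x) = x)
    (h : Module.Injective R M) : Module.Injective R N :=
  idim_retract (n := 0) i r hr h

end InjDim

open CategoryTheory

section Abstract

/-- The relations satisfied by a pair of non-unital homomorphisms that are glued along the
idempotents `ea` and `eb`. -/
def GlueRel {K A B E : Type} [Field K] [Ring A] [Algebra K A] [Ring B] [Algebra K B]
    [Ring E] [Algebra K E] (ea : A) (eb : B) (φA : A →ₙₐ[K] E) (φB : B →ₙₐ[K] E) : Prop :=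
  φA ea = φB eb ∧ φA 1 * φB 1 = φA ea ∧ φB 1 * φA 1 = φA ea ∧ φA 1 + φB 1 = 1 + φA ea

/-- An abstract characterization of the simple gluing algebra `L` of `A` and `B`. -/
structure GlueRing (K A B L : Type) [Field K] [Ring A] [Algebra K A] [Ring B] [Algebra K B]
    [Ring L] [Algebra K L] where
  ea : A
  eb : B
  ida : ea * ea = ea
  idb : eb * eb = eb
  iA : A →ₙₐ[K] L
  iB : B →ₙₐ[K] L
  rel : GlueRel ea eb iA iB
  gen : Algebra.adjoin K (Set.range iA ∪ Set.range iB) = ⊤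
  lift : ∀ (E : Type) [Ring E] [Algebra K E] (φA : A →ₙₐ[K] E) (φB : B →ₙₐ[K] E),
    GlueRel ea eb φA φB → ∃ Φ : L →ₐ[K] E, (∀ x, Φ (iA x) = φA x) ∧ (∀ y, Φ (iB y) = φB y)
  χA : A →ₐ[K] K
  χB : B →ₐ[K] K
  χea : χA ea = 1
  χeb : χB eb = 1
  fin : FiniteDimensional K L

variable {K A B L : Type} [Field K] [Ring A] [Algebra K A] [Ring B] [Algebra K B]
    [Ring L] [Algebra K L]

theorem GlueRel.swap {E : Type} [Ring E] [Algebra K E] {ea : A} {eb : B}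
    {φA : A →ₙₐ[K] E} {φB : B →ₙₐ[K] E} (h : GlueRel ea eb φA φB) : GlueRel eb ea φB φA := by
  obtain ⟨h1, h2, h3, h4⟩ := h
  exact ⟨h1.symm, h3.trans h1, h2.trans h1, by rw [add_comm, h4, h1]⟩

/-- The abstract gluing situation is symmetric in `A` and `B`. -/
def GlueRing.swap (G : GlueRing K A B L) : GlueRing K B A L where
  ea := G.eb
  eb := G.ea
  ida := G.idb
  idb := G.ida
  iA := G.iB
  iB := G.iA
  rel := G.rel.swap
  gen := by rw [Set.union_comm]; exact G.gen
  lift := fun E _ _ φA φB h => by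
    obtain ⟨Φ, h1, h2⟩ := G.lift E φB φA h.swap
    exact ⟨Φ, h2, h1⟩
  χA := G.χB
  χB := G.χA
  χea := G.χeb
  χeb := G.χea
  fin := G.fin

/-- The opposite of a non-unital homomorphism. -/
def opHom {E : Type} [Ring E] [Algebra K E] (f : A →ₙₐ[K] E) : Aᵐᵒᵖ →ₙₐ[K] Eᵐᵒᵖ where
  toFun x := MulOpposite.op (f x.unop)
  map_smul' k x := by simp
  map_zero' := by simp
  map_add' x y := by simp
  map_mul' x y := by simp

/-- A non-unital homomorphism into an algebra from an opposite algebra, with sides exchanged. -/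
def opHom' {E : Type} [Ring E] [Algebra K E] (f : Aᵐᵒᵖ →ₙₐ[K] E) : A →ₙₐ[K] Eᵐᵒᵖ where
  toFun x := MulOpposite.op (f (MulOpposite.op x))
  map_smul' k x := by simp
  map_zero' := by simp
  map_add' x y := by simp
  map_mul' x y := by simp

/-- The abstract gluing situation is stable under passing to opposite algebras. -/
def GlueRing.op (G : GlueRing K A B L) : GlueRing K Aᵐᵒᵖ Bᵐᵒᵖ Lᵐᵒᵖ where
  ea := MulOpposite.op G.ea
  eb := MulOpposite.op G.eb
  ida := by rw [← MulOpposite.op_mul, G.ida]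
  idb := by rw [← MulOpposite.op_mul, G.idb]
  iA := opHom G.iA
  iB := opHom G.iB
  rel := by
    obtain ⟨h1, h2, h3, h4⟩ := G.rel
    refine ⟨congrArg MulOpposite.op h1, congrArg MulOpposite.op h3, congrArg MulOpposite.op h2,
      congrArg MulOpposite.op h4⟩
  gen := by
    have key : ∀ x : L, MulOpposite.op x ∈
        Algebra.adjoin K (Set.range (opHom G.iA) ∪ Set.range (opHom G.iB)) := by
      intro x
      have hx : x ∈ Algebra.adjoin K (Set.range G.iA ∪ Set.range G.iB) := by
        rw [G.gen]; trivial
      induction hx using Algebra.adjoin_induction with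
      | mem x hx =>
        apply Algebra.subset_adjoin
        rcases hx with ⟨y, rfl⟩ | ⟨y, rfl⟩
        · exact Or.inl ⟨MulOpposite.op y, rfl⟩
        · exact Or.inr ⟨MulOpposite.op y, rfl⟩
      | algebraMap r => exact Subalgebra.algebraMap_mem _ r
      | add x y _ _ hx hy => exact Subalgebra.add_mem _ hx hy
      | mul x y _ _ hx hy => exact Subalgebra.mul_mem _ hy hx
    rw [eq_top_iff]
    intro x _
    exact key x.unop
  lift := fun E _ _ φA φB h => by
    obtain ⟨h1, h2, h3, h4⟩ := h
    obtain ⟨Φ, k1, k2⟩ := G.lift Eᵐᵒᵖ (opHom' φA) (opHom' φB)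
      ⟨congrArg MulOpposite.op h1, congrArg MulOpposite.op h3, congrArg MulOpposite.op h2,
      congrArg MulOpposite.op h4⟩
    refine ⟨AlgHom.ofLinearMap
      { toFun := fun x => (Φ x.unop).unop
        map_add' := by intro x y; simp
        map_smul' := by intro x y; simp } ?_ ?_, ?_, ?_⟩
    · simp
    · intro x y; simp
    · intro x
      have := congrArg MulOpposite.unop (k1 x.unop)
      exact this
    · intro x
      have := congrArg MulOpposite.unop (k2 x.unop)
      exact this
  χA := AlgHom.ofLinearMap
      { toFun := fun x => G.χA x.unop
        map_add' := by intro x y; simp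
        map_smul' := by intro x y; simp } (by simp) (by intro x y; simp [mul_comm])
  χB := AlgHom.ofLinearMap
      { toFun := fun x => G.χB x.unop
        map_add' := by intro x y; simp
        map_smul' := by intro x y; simp } (by simp) (by intro x y; simp [mul_comm])
  χea := G.χea
  χeb := G.χeb
  fin := by
    have := G.fin
    exact Module.Finite.equiv (MulOpposite.opLinearEquiv K : L ≃ₗ[K] Lᵐᵒᵖ)

/-- The corner `f(1) M` of an `L`-module with respect to a non-unital homomorphism. -/
def Cor (f : A →ₙₐ[K] L) (M : Type) [AddCommGroup M] [Module L M] [Module K M]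
    [IsScalarTower K L M] : Submodule K M where
  carrier := {m | f 1 • m = m}
  add_mem' := by
    intro x y hx hy
    change f 1 • (x + y) = x + y
    rw [smul_add]
    exact congrArg₂ _ hx hy
  zero_mem' := smul_zero _
  smul_mem' := by
    intro k x hx
    change f 1 • (k • x) = k • x
    have hx' : f 1 • x = x := hx
    rw [← algebraMap_smul L k x, smul_smul, ← Algebra.commutes, mul_smul, hx']

section CorSec

variable (f : A →ₙₐ[K] L) (M : Type) [AddCommGroup M] [Module L M] [Module K M]
    [IsScalarTower K L M]

variable {M} in
theorem Cor.mem_iff (m : M) : m ∈ Cor f M ↔ f 1 • m = m := Iff.rfl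

variable {M} in
theorem Cor.smul_mem (x : A) (m : M) : f x • m ∈ Cor f M := by
  rw [Cor.mem_iff, smul_smul, ← map_mul, one_mul]

instance Cor.instModule : Module A (Cor f M) where
  smul x m := ⟨f x • (m : M), Cor.smul_mem f x (m : M)⟩
  one_smul m := Subtype.ext m.2
  mul_smul x y m := Subtype.ext (by change f (x * y) • (m : M) = f x • f y • (m : M); rw [map_mul, mul_smul])
  smul_zero x := Subtype.ext (smul_zero _)
  smul_add x m n := Subtype.ext (smul_add _ _ _)
  add_smul x y m := Subtype.ext (by change f (x + y) • (m : M) = f x • (m : M) + f y • (m : M); rw [map_add, add_smul])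
  zero_smul m := Subtype.ext (by change f 0 • (m : M) = 0; rw [map_zero, zero_smul])

variable {M} in
@[simp]
theorem Cor.coe_smul (x : A) (m : Cor f M) : ((x • m : Cor f M) : M) = f x • (m : M) := rfl

instance Cor.instTower : IsScalarTower K A (Cor f M) where
  smul_assoc k x m := Subtype.ext (by
    change f (k • x) • (m : M) = k • (f x • (m : M))
    rw [map_smul, smul_assoc])

/-- The projection of a module onto a corner. -/
def Cor.proj : M →ₗ[K] Cor f M where
  toFun m := ⟨f 1 • m, Cor.smul_mem f 1 m⟩
  map_add' m n := Subtype.ext (smul_add _ _ _)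
  map_smul' k m := Subtype.ext (by
    change f 1 • (k • m) = k • (f 1 • m)
    rw [← algebraMap_smul L k m, smul_smul, ← Algebra.commutes, mul_smul, algebraMap_smul])

variable {M} in
@[simp]
theorem Cor.coe_proj (m : M) : (Cor.proj f M m : M) = f 1 • m := rfl

variable {M}
variable {N : Type} [AddCommGroup N] [Module L N] [Module K N] [IsScalarTower K L N]

/-- The corner functor on morphisms. -/
def Cor.map (g : M →ₗ[L] N) : Cor f M →ₗ[A] Cor f N where
  toFun m := ⟨g m, by rw [Cor.mem_iff, ← map_smul, (Cor.mem_iff f (m : M)).mp m.2]⟩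
  map_add' m n := Subtype.ext (map_add g _ _)
  map_smul' k m := Subtype.ext (by simp)

@[simp]
theorem Cor.coe_map (g : M →ₗ[L] N) (m : Cor f M) : (Cor.map f g m : N) = g m := rfl

theorem Cor.map_inj (g : M →ₗ[L] N) (hg : Function.Injective g) :
    Function.Injective (Cor.map f g) := fun x y h =>
  Subtype.ext (hg (congrArg Subtype.val h))

theorem Cor.map_surj (g : M →ₗ[L] N) (hg : Function.Surjective g) :
    Function.Surjective (Cor.map f g) := by
  intro y
  obtain ⟨x, hx⟩ := hg y
  refine ⟨Cor.proj f M x, Subtype.ext ?_⟩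
  simp [hx, (Cor.mem_iff f (y : N)).mp y.2]

theorem Cor.map_exact {P : Type} [AddCommGroup P] [Module L P] [Module K P] [IsScalarTower K L P]
    (g : M →ₗ[L] N) (h : N →ₗ[L] P) (hgh : Function.Exact g h) :
    Function.Exact (Cor.map f g) (Cor.map f h) := by
  intro y
  constructor
  · intro hy
    obtain ⟨x, hx⟩ := (hgh y).mp (congrArg Subtype.val hy)
    refine ⟨Cor.proj f M x, Subtype.ext ?_⟩
    simp [hx, (Cor.mem_iff f (y : N)).mp y.2]
  · rintro ⟨x, rfl⟩
    exact Subtype.ext (hgh.apply_apply_eq_zero x)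

end CorSec

/-- The scalar tower for modules obtained by restriction along the structure map. -/
theorem tower_compHom (L M : Type) [Ring L] [Algebra K L] [AddCommGroup M] [Module L M] :
    letI : Module K M := Module.compHom M (algebraMap K L)
    IsScalarTower K L M := by
  letI : Module K M := Module.compHom M (algebraMap K L)
  refine ⟨fun k l m => ?_⟩
  rw [Algebra.smul_def, mul_smul]
  rfl

namespace GlueRing

variable (G : GlueRing K A B L)

theorem gen_linear {M E : Type} [AddCommGroup M] [Module L M] [Module K M] [IsScalarTower K L M]
    [AddCommGroup E] [Module K E] (Φ : L →ₐ[K] Module.End K E) (F : M →ₗ[K] E)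
    (h1 : ∀ x m, F (G.iA x • m) = Φ (G.iA x) (F m))
    (h2 : ∀ x m, F (G.iB x • m) = Φ (G.iB x) (F m)) (l : L) : ∀ m, F (l • m) = Φ l (F m) := by
  have hx : l ∈ Algebra.adjoin K (Set.range G.iA ∪ Set.range G.iB) := by
    rw [G.gen]; trivial
  induction hx using Algebra.adjoin_induction with
  | mem x hx =>
    rcases hx with ⟨y, rfl⟩ | ⟨y, rfl⟩
    · exact h1 y
    · exact h2 y
  | algebraMap r =>
    intro m
    rw [algebraMap_smul, map_smul, AlgHom.commutes]
    rfl
  | add x y _ _ hx hy =>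
    intro m
    rw [add_smul, map_add, hx, hy, map_add]; rfl
  | mul x y _ _ hx hy =>
    intro m
    rw [mul_smul, hx, hy, map_mul]; rfl

theorem gen_linear' {M E : Type} [AddCommGroup M] [Module L M] [Module K M] [IsScalarTower K L M]
    [AddCommGroup E] [Module K E] (Φ : L →ₐ[K] Module.End K E) (F : E →ₗ[K] M)
    (h1 : ∀ x m, F (Φ (G.iA x) m) = G.iA x • F m)
    (h2 : ∀ x m, F (Φ (G.iB x) m) = G.iB x • F m) (l : L) : ∀ m, F (Φ l m) = l • F m := by
  have hx : l ∈ Algebra.adjoin K (Set.range G.iA ∪ Set.range G.iB) := by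
    rw [G.gen]; trivial
  induction hx using Algebra.adjoin_induction with
  | mem x hx =>
    rcases hx with ⟨y, rfl⟩ | ⟨y, rfl⟩
    · exact h1 y
    · exact h2 y
  | algebraMap r =>
    intro m
    rw [algebraMap_smul, ← map_smul, AlgHom.commutes]
    rfl
  | add x y _ _ hx hy =>
    intro m
    rw [add_smul, ← hx, ← hy, map_add Φ, ← map_add F]; rfl
  | mul x y _ _ hx hy =>
    intro m
    rw [mul_smul, ← hy, ← hx, map_mul]; rfl

/-- An injective `L`-module is a retract of every glued representation containing it. -/
theorem retract {J E : Type} [AddCommGroup J] [Module L J] [Module K J] [IsScalarTower K L J]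
    [AddCommGroup E] [Module K E] (hJ : Module.Injective L J)
    (φA : A →ₙₐ[K] Module.End K E) (φB : B →ₙₐ[K] Module.End K E)
    (hrel : GlueRel G.ea G.eb φA φB) (ι : J →ₗ[K] E) (hι : Function.Injective ι)
    (h1 : ∀ x j, ι (G.iA x • j) = φA x (ι j)) (h2 : ∀ x j, ι (G.iB x • j) = φB x (ι j)) :
    ∃ ρ : E →ₗ[K] J, (∀ x z, ρ (φA x z) = G.iA x • ρ z) ∧ (∀ x z, ρ (φB x z) = G.iB x • ρ z) ∧
      ∀ j, ρ (ι j) = j := by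
  obtain ⟨Φ, k1, k2⟩ := G.lift _ φA φB hrel
  letI : Module L E := Module.compHom E Φ.toRingHom
  have hsm : ∀ (l : L) (z : E), l • z = Φ l z := fun _ _ => rfl
  have hlin := G.gen_linear Φ ι (by simpa [k1] using h1) (by simpa [k2] using h2)
  let ι' : J →ₗ[L] E := { toFun := ι, map_add' := map_add ι, map_smul' := hlin }
  obtain ⟨ρ, hρ⟩ := hJ.out ι' hι LinearMap.id
  refine ⟨{ toFun := ρ, map_add' := map_add ρ, map_smul' := ?_ }, ?_, ?_, hρ⟩
  · intro k z
    have : k • z = (algebraMap K L k) • z := by rw [hsm, AlgHom.commutes]; rfl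
    rw [this, map_smul, algebraMap_smul]; rfl
  · intro x z
    change ρ _ = _ • ρ z
    rw [← map_smul, hsm, k1]
  · intro x z
    change ρ _ = _ • ρ z
    rw [← map_smul, hsm, k2]

end GlueRing

end Abstract

open CategoryTheory

section Abstract2

variable {K A B L : Type} [Field K] [Ring A] [Algebra K A] [Ring B] [Algebra K B]
    [Ring L] [Algebra K L]

/-- Data for gluing an `A`-module and a `B`-module along the corners at `ea` and `eb`. -/
structure PBData (K : Type) {A B : Type} [Field K] [Ring A] [Algebra K A] [Ring B] [Algebra K B]
    (ea : A) (eb : B) (M N : Type) [AddCommGroup M] [Module K M] [Module A M] [IsScalarTower K A M]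
    [AddCommGroup N] [Module K N] [Module B N] [IsScalarTower K B N] where
  s : M →ₗ[K] N
  t : N →ₗ[K] M
  hs : ∀ m, s (ea • m) = s m
  ht : ∀ n, t (eb • n) = t n
  ts : ∀ m, t (s m) = ea • m
  st : ∀ n, s (t n) = eb • n

namespace PBData

variable {ea : A} {eb : B} {M N : Type} [AddCommGroup M] [Module K M] [Module A M]
    [IsScalarTower K A M]
    [AddCommGroup N] [Module K N] [Module B N] [IsScalarTower K B N] (D : PBData K ea eb M N)

theorem eb_s (m : M) : eb • D.s m = D.s m := by rw [← D.st, D.ts, D.hs]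

theorem ea_t (n : N) : ea • D.t n = D.t n := by rw [← D.ts, D.st, D.ht]

/-- The glued vector space. -/
def E : Submodule K (M × N) where
  carrier := {p | D.s p.1 = eb • p.2}
  add_mem' := by
    intro p q hp hq
    change D.s (p.1 + q.1) = eb • (p.2 + q.2)
    rw [map_add, smul_add]
    exact congrArg₂ _ hp hq
  zero_mem' := by
    change D.s 0 = eb • (0 : N)
    simp
  smul_mem' := by
    intro k p hp
    change D.s (k • p.1) = eb • (k • p.2)
    have hp' : D.s p.1 = eb • p.2 := hp
    rw [map_smul, hp', ← algebraMap_smul B k p.2, smul_smul, ← Algebra.commutes, mul_smul,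
      algebraMap_smul]

theorem mem_E (p : M × N) : p ∈ D.E ↔ D.s p.1 = eb • p.2 := Iff.rfl

theorem prop (z : D.E) : D.s z.1.1 = eb • z.1.2 := z.2

theorem prop' (z : D.E) : D.t z.1.2 = ea • z.1.1 := by
  rw [← D.ht, ← D.prop, D.ts]

theorem smulK (k : K) (x : A) (m : M) : x • (k • m) = k • (x • m) := by
  rw [← algebraMap_smul A k m, smul_smul, ← Algebra.commutes, mul_smul, algebraMap_smul]

/-- The action of `A` on the glued space. -/
def actA : A →ₙₐ[K] Module.End K D.E where
  toFun x :=
    { toFun := fun z => ⟨(x • z.1.1, D.s (x • z.1.1)), by rw [mem_E, D.eb_s]⟩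
      map_add' := by
        intro z w
        apply Subtype.ext
        simp
      map_smul' := by
        intro k z
        apply Subtype.ext
        simp [smulK] }
  map_smul' k x := by
    ext z : 1
    apply Subtype.ext
    simp
  map_zero' := by
    ext z : 1
    apply Subtype.ext
    simp
  map_add' x y := by
    ext z : 1
    apply Subtype.ext
    simp [add_smul]
  map_mul' x y := by
    ext z : 1
    apply Subtype.ext
    simp [mul_smul]

/-- The action of `B` on the glued space. -/
def actB : B →ₙₐ[K] Module.End K D.E where
  toFun y :=
    { toFun := fun z => ⟨(D.t (y • z.1.2), y • z.1.2), by rw [mem_E, D.st]⟩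
      map_add' := by
        intro z w
        apply Subtype.ext
        simp
      map_smul' := by
        intro k z
        apply Subtype.ext
        simp [smulK] }
  map_smul' k x := by
    ext z : 1
    apply Subtype.ext
    simp
  map_zero' := by
    ext z : 1
    apply Subtype.ext
    simp
  map_add' x y := by
    ext z : 1
    apply Subtype.ext
    simp [add_smul]
  map_mul' x y := by
    ext z : 1
    apply Subtype.ext
    simp [mul_smul]

theorem coe_actA (x : A) (z : D.E) : (D.actA x z : M × N) = (x • z.1.1, D.s (x • z.1.1)) := rfl

theorem coe_actB (x : B) (z : D.E) : (D.actB x z : M × N) = (D.t (x • z.1.2), x • z.1.2) := rfl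

theorem rel : GlueRel ea eb D.actA D.actB := by
  refine ⟨?_, ?_, ?_, ?_⟩
  · ext z : 1
    apply Subtype.ext
    rw [coe_actA, coe_actB, D.ht, D.hs, D.prop', D.prop]
  · ext z : 1
    apply Subtype.ext
    rw [Module.End.mul_apply, coe_actA, coe_actB, coe_actA, one_smul, one_smul, D.hs, D.prop',
      D.hs]
  · ext z : 1
    apply Subtype.ext
    rw [Module.End.mul_apply, coe_actB, coe_actA, coe_actA, one_smul, one_smul, D.hs, D.ts]
  · ext z : 1
    apply Subtype.ext
    rw [LinearMap.add_apply, LinearMap.add_apply, Submodule.coe_add, Submodule.coe_add, coe_actA,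
      coe_actA, coe_actB, one_smul, one_smul, D.hs, D.prop', Module.End.one_apply]
    ext
    · rfl
    · simp [add_comm]

end PBData

namespace GlueRing

variable (G : GlueRing K A B L)

section basics

theorem r1 : G.iA G.ea = G.iB G.eb := G.rel.1
theorem r2 : G.iA 1 * G.iB 1 = G.iA G.ea := G.rel.2.1
theorem r3 : G.iB 1 * G.iA 1 = G.iA G.ea := G.rel.2.2.1
theorem r4 : G.iA 1 + G.iB 1 = 1 + G.iA G.ea := G.rel.2.2.2

theorem iBA (x : A) : G.iB 1 * G.iA x = G.iA (G.ea * x) := by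
  rw [map_mul, ← G.r3, mul_assoc, ← map_mul, one_mul]

theorem iAB (x : B) : G.iA 1 * G.iB x = G.iB (G.eb * x) := G.swap.iBA x

theorem iBA' (x : A) : G.iA x * G.iB 1 = G.iA (x * G.ea) := by
  rw [map_mul, ← G.r2, ← mul_assoc, ← map_mul, mul_one]

theorem iAB' (x : B) : G.iB x * G.iA 1 = G.iB (x * G.eb) := G.swap.iBA' x

variable (J : Type) [AddCommGroup J] [Module L J] [Module K J] [IsScalarTower K L J]

/-- The transfer map between the corners of a module over the glued algebra. -/
def tAB : Cor G.iA J →ₗ[K] Cor G.iB J where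
  toFun j := ⟨G.iA G.ea • (j : J), by
    rw [Cor.mem_iff, smul_smul, iBA, G.ida]⟩
  map_add' m n := Subtype.ext (smul_add _ _ _)
  map_smul' k m := Subtype.ext (by
    change G.iA G.ea • (k • (m : J)) = k • (G.iA G.ea • (m : J))
    exact PBData.smulK k _ _)

/-- The transfer map in the other direction. -/
def tBA : Cor G.iB J →ₗ[K] Cor G.iA J := G.swap.tAB J

variable {J}

theorem coe_tBA (j : Cor G.iB J) : (G.tBA J j : J) = G.iB G.eb • (j : J) := rfl

theorem coe_tAB (j : Cor G.iA J) : (G.tAB J j : J) = G.iA G.ea • (j : J) := rfl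

theorem tAB_tBA (j : Cor G.iB J) : G.tAB J (G.tBA J j) = G.eb • j := by
  apply Subtype.ext
  rw [coe_tAB, coe_tBA, Cor.coe_smul, G.r1, smul_smul, ← map_mul, G.idb]

theorem tBA_tAB (j : Cor G.iA J) : G.tBA J (G.tAB J j) = G.ea • j := G.swap.tAB_tBA j

theorem tAB_ea (j : Cor G.iA J) : G.tAB J (G.ea • j) = G.tAB J j := by
  apply Subtype.ext
  rw [coe_tAB, coe_tAB, Cor.coe_smul, smul_smul, ← map_mul, G.ida]

theorem tBA_eb (j : Cor G.iB J) : G.tBA J (G.eb • j) = G.tBA J j := G.swap.tAB_ea j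

theorem ea_tBA (j : Cor G.iB J) : G.ea • G.tBA J j = G.tBA J j := by
  rw [← tBA_tAB, tAB_tBA, tBA_eb]

theorem eb_tAB (j : Cor G.iA J) : G.eb • G.tAB J j = G.tAB J j := G.swap.ea_tBA j

theorem tAB_proj (j : J) : G.tAB J (Cor.proj G.iA J j) = G.eb • Cor.proj G.iB J j := by
  apply Subtype.ext
  rw [coe_tAB, Cor.coe_smul, Cor.coe_proj, Cor.coe_proj, smul_smul, smul_smul, ← map_mul,
    ← map_mul, mul_one, mul_one, r1]

theorem projA_smul (x : A) (j : J) :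
    Cor.proj G.iA J (G.iA x • j) = x • Cor.proj G.iA J j := by
  apply Subtype.ext
  rw [Cor.coe_smul, Cor.coe_proj, Cor.coe_proj, smul_smul, smul_smul, ← map_mul,
    ← map_mul, mul_one, one_mul]

theorem projB_smul (x : A) (j : J) :
    Cor.proj G.iB J (G.iA x • j) = G.tAB J (x • Cor.proj G.iA J j) := by
  apply Subtype.ext
  rw [coe_tAB, Cor.coe_smul, Cor.coe_proj, Cor.coe_proj, smul_smul, smul_smul, smul_smul, iBA,
    ← map_mul, ← map_mul, mul_one]

theorem projA_smulB (x : B) (j : J) :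
    Cor.proj G.iA J (G.iB x • j) = G.tBA J (x • Cor.proj G.iB J j) := G.swap.projB_smul x j

theorem projBB_smul (x : B) (j : J) :
    Cor.proj G.iB J (G.iB x • j) = x • Cor.proj G.iB J j := G.swap.projA_smul x j

theorem proj_coe (j : Cor G.iA J) : Cor.proj G.iA J (j : J) = j := Subtype.ext j.2

theorem projB_coe (j : Cor G.iA J) : Cor.proj G.iB J (j : J) = G.tAB J j := by
  have := G.projB_smul 1 (j : J)
  rwa [one_smul, proj_coe, (Cor.mem_iff G.iA (j : J)).mp j.2] at this

theorem decomp (j : J) : j = (Cor.proj G.iA J j : J) + (Cor.proj G.iB J j : J) - G.iA G.ea • j := by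
  rw [Cor.coe_proj, Cor.coe_proj, ← add_smul, r4, add_smul, one_smul]
  abel

end basics

section mixed

variable {I J : Type} [AddCommGroup J] [Module L J] [Module K J] [IsScalarTower K L J]
  [AddCommGroup I] [Module A I] [Module K I] [IsScalarTower K A I]
  (u : Cor G.iA J →ₗ[K] I) (v : I →ₗ[K] Cor G.iA J)

/-- The complement used to extend the action of `B` through the simple module. -/
def Wsub : Submodule K I where
  carrier := {w | G.ea • w = w ∧ v w = 0}
  add_mem' := by
    rintro x y ⟨h1, h2⟩ ⟨h3, h4⟩
    exact ⟨by rw [smul_add, h1, h3], by rw [map_add, h2, h4, add_zero]⟩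
  zero_mem' := ⟨smul_zero _, map_zero _⟩
  smul_mem' := by
    rintro k x ⟨h1, h2⟩
    exact ⟨by rw [PBData.smulK, h1], by rw [map_smul, h2, smul_zero]⟩

instance Wsub.instModule : Module B (G.Wsub v) := Module.compHom _ G.χB.toRingHom

theorem Wsub.smul_def (y : B) (w : G.Wsub v) : y • w = (G.χB y) • w := rfl

instance Wsub.instTower : IsScalarTower K B (G.Wsub v) where
  smul_assoc k y w := by
    rw [Wsub.smul_def, Wsub.smul_def, map_smul, smul_assoc]

/-- Gluing an `A`-module containing (or covering) the corner of `J` with the other corner. -/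
def mixed (hu : ∀ j, G.ea • u j = u (G.ea • j)) (hv : ∀ i, G.ea • v i = v (G.ea • i))
    (hvu : ∀ j, v (u (G.ea • j)) = G.ea • j) :
    PBData K G.ea G.eb I (Cor G.iB J × G.Wsub v) where
  s :=
    { toFun := fun i => (G.tAB J (v i), ⟨G.ea • i - u (G.ea • v i), by
        constructor
        · rw [smul_sub, hu, smul_smul, smul_smul, G.ida]
        · rw [map_sub, hvu, hv, sub_self]⟩)
      map_add' := by
        intro x y
        ext
        · simp
        · simp only [map_add, smul_add, Prod.snd_add, Submodule.coe_add]
          abel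
      map_smul' := by
        intro k x
        ext
        · simp
        · simp [PBData.smulK, smul_sub] }
  t := (u ∘ₗ G.tBA J).coprod (G.Wsub v).subtype
  hs := by
    intro m
    ext
    · simp [← hv, G.tAB_ea]
    · simp [← hv, smul_smul, G.ida]
  ht := by
    rintro ⟨j, w⟩
    simp [Wsub.smul_def, G.χeb, G.tBA_eb]
  ts := by
    intro m
    simp [tBA_tAB]
  st := by
    rintro ⟨j, w⟩
    have hw : G.ea • (w : I) = w ∧ v w = 0 := w.2
    have hvt : v (u (G.tBA J j)) = G.tBA J j := by
      rw [← G.ea_tBA, hvu]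
    ext
    · simp [hvt, hw.2, tAB_tBA]
    · simp [hvt, hw, Wsub.smul_def, G.χeb, hu, G.ea_tBA]

end mixed

end GlueRing

end Abstract2

open CategoryTheory

section Abstract3

variable {K A B L : Type} [Field K] [Ring A] [Algebra K A] [Ring B] [Algebra K B]
    [Ring L] [Algebra K L]

namespace GlueRing

variable (G : GlueRing K A B L)

/-- The corner of an injective module is injective. -/
theorem corA_inj (J : Type) [AddCommGroup J] [Module L J] [Module K J] [IsScalarTower K L J]
    (hJ : Module.Injective L J) : Module.Injective A (Cor G.iA J) := by
  obtain ⟨I, _, _, hI, ι, hι⟩ := idim_exists_inj (R := A) (Cor G.iA J)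
  let _ : Module K I := Module.compHom I (algebraMap K A)
  have _ : IsScalarTower K A I := tower_compHom A I
  obtain ⟨r, hr⟩ := LinearMap.exists_leftInverse_of_injective (ι.restrictScalars K)
    (LinearMap.ker_eq_bot.mpr hι)
  have hr' : ∀ j, r (ι j) = j := fun j => LinearMap.congr_fun hr j
  let v : I →ₗ[K] Cor G.iA J :=
    { toFun := fun i => G.ea • r (G.ea • i)
      map_add' := by intro x y; simp
      map_smul' := by intro k x; simp [PBData.smulK] }
  have hv0 : ∀ i, v i = G.ea • r (G.ea • i) := fun _ => rfl
  have hv : ∀ i, G.ea • v i = v (G.ea • i) := by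
    intro i
    simp only [hv0, smul_smul, G.ida]
  have hvu : ∀ j, v (ι j) = G.ea • j := by
    intro j
    rw [hv0, ← map_smul ι, hr', smul_smul, G.ida]
  let D := G.mixed (ι.restrictScalars K) v (fun j => (map_smul ι _ _).symm) hv (by
    intro j
    change v (ι _) = _
    rw [hvu, smul_smul, G.ida])
  have hDs : ∀ i, D.s i = (G.tAB J (v i), ⟨G.ea • i - ι (G.ea • v i), (D.s i).2.2⟩) :=
    fun i => rfl
  have hDt : ∀ j w, D.t (j, w) = ι (G.tBA J j) + (w : I) := fun j w => by
    change ((ι.restrictScalars K) ∘ₗ G.tBA J).coprod (G.Wsub v).subtype (j, w) = _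
    rw [LinearMap.coprod_apply]; rfl
  have hDsι : ∀ j, D.s (ι j) = (G.tAB J j, 0) := by
    intro j
    refine Prod.ext ?_ (Subtype.ext ?_)
    · change G.tAB J (v (ι j)) = G.tAB J j
      rw [hvu, G.tAB_ea]
    · change G.ea • ι j - ι (G.ea • v (ι j)) = 0
      rw [hvu, smul_smul, G.ida, ← map_smul, sub_self]
  let κ : J →ₗ[K] D.E :=
    { toFun := fun j => ⟨(ι (Cor.proj G.iA J j), (Cor.proj G.iB J j, 0)), by
        rw [PBData.mem_E]
        dsimp only
        rw [hDsι, tAB_proj, Prod.smul_mk, smul_zero]⟩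
      map_add' := by
        intro x y
        apply Subtype.ext
        simp
      map_smul' := by
        intro k x
        apply Subtype.ext
        have := (ι.restrictScalars K).map_smul k (Cor.proj G.iA J x)
        simpa using this }
  have hκ : ∀ j, (κ j : I × (Cor G.iB J × G.Wsub v)) =
    (ι (Cor.proj G.iA J j), (Cor.proj G.iB J j, 0)) := fun _ => rfl
  obtain ⟨ρ, h1, h2, h3⟩ := G.retract hJ D.actA D.actB D.rel κ (by
      intro x y hxy
      have hxy' := congrArg Subtype.val hxy
      rw [hκ, hκ] at hxy'
      have e1 := hι (congrArg Prod.fst hxy')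
      have e2 : Cor.proj G.iB J x = Cor.proj G.iB J y := congrArg (fun z => z.2.1) hxy'
      have e3 : G.iA G.ea • x = G.iA G.ea • y := by
        have := congrArg (fun z : Cor G.iA J => G.iA G.ea • (z : J)) e1
        simpa [smul_smul, ← map_mul] using this
      rw [G.decomp x, G.decomp y, e1, e2, e3])
    (by
      intro x j
      apply Subtype.ext
      rw [PBData.coe_actA, hκ, hκ]
      dsimp only
      rw [← map_smul, hDsι, projA_smul, projB_smul])
    (by
      intro x j
      apply Subtype.ext
      rw [PBData.coe_actB, hκ, hκ]
      dsimp only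
      rw [Prod.smul_mk, hDt, projA_smulB, projBB_smul, smul_zero]
      simp)
  let inc : I → D.E := fun i => ⟨(i, D.s i), by rw [PBData.mem_E, D.eb_s]⟩
  have hinc : ∀ (x : A) i, inc (x • i) = D.actA x (inc i) := fun x i => Subtype.ext rfl
  let R : I →ₗ[A] Cor G.iA J :=
    { toFun := fun i => ⟨ρ (inc i), by
        rw [Cor.mem_iff, ← h1, ← hinc, one_smul]⟩
      map_add' := by
        intro x y
        apply Subtype.ext
        have : inc (x + y) = inc x + inc y := Subtype.ext (by simp [inc])
        simp [this]
      map_smul' := by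
        intro k x
        apply Subtype.ext
        simp [hinc, h1] }
  refine inj_of_retract ι R ?_ hI
  intro j
  apply Subtype.ext
  change ρ (inc (ι j)) = j
  have : inc (ι j) = κ (j : J) := by
    apply Subtype.ext
    rw [hκ, proj_coe, projB_coe, ← hDsι]
  rw [this, h3]

theorem lift_end {E : Type} [AddCommGroup E] [Module K E]
    (φA : A →ₙₐ[K] Module.End K E) (φB : B →ₙₐ[K] Module.End K E)
    (hrel : GlueRel G.ea G.eb φA φB) : ∃ Φ : L →ₐ[K] Module.End K E,
      (∀ x, Φ (G.iA x) = φA x) ∧ (∀ y, Φ (G.iB y) = φB y) := G.lift _ φA φB hrel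

/-- Every surjection onto the corner of the regular module splits. -/
theorem corA_split (J : Type) [AddCommGroup J] [Module L J] [Module K J] [IsScalarTower K L J]
    (o : J) (c : J →ₗ[L] L) (hc : ∀ j, c j • o = j) (P : Type) [AddCommGroup P] [Module A P] [Module K P] [IsScalarTower K A P]
    (π : P →ₗ[A] Cor G.iA J) (hπ : Function.Surjective π) :
    ∃ τ : Cor G.iA J →ₗ[A] P, ∀ x, π (τ x) = x := by
  obtain ⟨σ, hσ⟩ := LinearMap.exists_rightInverse_of_surjective (π.restrictScalars K)
    (LinearMap.range_eq_top.mpr hπ)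
  have hσ' : ∀ j, π (σ j) = j := fun j => LinearMap.congr_fun hσ j
  let u : Cor G.iA J →ₗ[K] P :=
    { toFun := fun i => G.ea • σ (G.ea • i)
      map_add' := by intro x y; simp
      map_smul' := by intro k x; rw [PBData.smulK, map_smul, PBData.smulK]; rfl }
  have hu0 : ∀ i, u i = G.ea • σ (G.ea • i) := fun _ => rfl
  have hu : ∀ i, G.ea • u i = u (G.ea • i) := by
    intro i
    simp only [hu0, smul_smul, G.ida]
  have hvu : ∀ j, π (u j) = G.ea • j := by
    intro j
    rw [hu0, map_smul, hσ', smul_smul, G.ida]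
  let v : P →ₗ[K] Cor G.iA J := π.restrictScalars K
  let D := G.mixed u v hu (fun j => (map_smul π _ _).symm) (by
    intro j
    change π (u _) = _
    rw [hvu, smul_smul, G.ida])
  have hDs : ∀ i, D.s i = (G.tAB J (π i), (D.s i).2) := fun i => rfl
  have hDt : ∀ j w, D.t (j, w) = u (G.tBA J j) + (w : P) := fun j w => by
    change (u ∘ₗ G.tBA J).coprod (G.Wsub v).subtype (j, w) = _
    rw [LinearMap.coprod_apply]; rfl
  obtain ⟨i0, hi0⟩ := hπ (Cor.proj G.iA J o)
  have hone : ∀ w : G.Wsub v, G.eb • w = w := fun w => by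
    rw [Wsub.smul_def, G.χeb, one_smul]
  let z0 : D.E := ⟨(i0, (Cor.proj G.iB J o, (D.s i0).2)), by
    rw [PBData.mem_E]
    dsimp only
    rw [hDs, hi0, tAB_proj, Prod.smul_mk, hone]⟩
  obtain ⟨Φ, k1, k2⟩ := G.lift_end D.actA D.actB D.rel
  let Ψ : D.E →ₗ[K] J :=
    { toFun := fun z => (π z.1.1 : J) + (z.1.2.1 : J) - G.iA G.ea • (π z.1.1 : J)
      map_add' := by
        intro x y
        simp only [Submodule.coe_add, Prod.fst_add, map_add, Prod.snd_add, smul_add]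
        abel
      map_smul' := by
        intro k x
        have := (π.restrictScalars K).map_smul k x.1.1
        simp only [LinearMap.coe_restrictScalars] at this
        simp [this, smul_sub, smul_add, PBData.smulK] }
  have hΨ : ∀ z, Ψ z = (π z.1.1 : J) + (z.1.2.1 : J) - G.iA G.ea • (π z.1.1 : J) := fun _ => rfl
  have hprop : ∀ z : D.E, G.tAB J (π z.1.1) = G.eb • z.1.2.1 := fun z =>
    congrArg Prod.fst (D.prop z)
  have hprop' : ∀ z : D.E, G.iA G.ea • (π z.1.1 : J) = G.iB G.eb • (z.1.2.1 : J) := fun z =>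
    congrArg Subtype.val (hprop z)
  have hlin : ∀ l z, Ψ (Φ l z) = l • Ψ z := by
    intro l
    refine G.gen_linear' Φ Ψ ?_ ?_ l
    · intro x z
      rw [k1, hΨ, hΨ, PBData.coe_actA, hDs]
      dsimp only
      have e1 : G.iA x • (z.1.2.1 : J) = G.iA x • (G.iA G.ea • (π z.1.1 : J)) := by
        rw [hprop' z, smul_smul, ← G.r1, ← map_mul, ← G.iBA', mul_smul]
        congr 1
        exact z.1.2.1.2.symm
      rw [coe_tAB, smul_sub, smul_add, e1, map_smul]
      simp
    · intro y z
      rw [k2, hΨ, hΨ, PBData.coe_actB]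
      dsimp only
      have e0 : π (D.t (y • z.1.2)) = G.tBA J (y • z.1.2.1) := by
        have e : y • z.1.2 = (y • z.1.2.1, y • z.1.2.2) := rfl
        have hw : π ((y • z.1.2.2 : G.Wsub v) : P) = 0 := (y • z.1.2.2 : G.Wsub v).2.2
        rw [e, hDt, map_add, hw, add_zero, hvu, ea_tBA]
      have e1 : G.iB y • (π z.1.1 : J) = G.iB y • (G.iA G.ea • (π z.1.1 : J)) := by
        rw [smul_smul, G.r1, ← map_mul, ← G.iAB', mul_smul]
        congr 1
        exact (π z.1.1).2.symm
      rw [e0, smul_sub, smul_add, ← e1, coe_tBA, smul_smul, ← G.r1, ← map_mul, G.ida]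
      simp
  have hz0 : Ψ z0 = o := by
    rw [hΨ]
    change (π i0 : J) + (Cor.proj G.iB J o : J) - G.iA G.ea • (π i0 : J) = o
    rw [hi0, Cor.coe_proj, Cor.coe_proj, smul_smul, ← map_mul, mul_one, ← add_smul, r4, add_smul,
      one_smul]
    abel
  have hΨA : ∀ z, Cor.proj G.iA J (Ψ z) = π z.1.1 := by
    intro z
    apply Subtype.ext
    have e1 : G.iA 1 • (z.1.2.1 : J) = G.iA G.ea • (π z.1.1 : J) := by
      rw [hprop' z, ← G.r1, ← G.r2, mul_smul]
      congr 1
      exact z.1.2.1.2.symm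
    rw [Cor.coe_proj, hΨ, smul_sub, smul_add, e1, smul_smul, ← map_mul, one_mul]
    have := (π z.1.1).2
    rw [Cor.mem_iff] at this
    rw [this]
    abel
  let τ : Cor G.iA J →ₗ[A] P :=
    { toFun := fun l => (Φ (c (l : J)) z0).1.1
      map_add' := by intro x y; simp
      map_smul' := by
        intro a x
        rw [Cor.coe_smul, map_smul, smul_eq_mul, map_mul, k1, Module.End.mul_apply, PBData.coe_actA]
        rfl }
  refine ⟨τ, ?_⟩
  intro x
  change π (Φ (c (x : J)) z0).1.1 = x
  rw [← hΨA, hlin, hz0, hc, proj_coe]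

/-- The corner of the regular module is a direct summand of a finite free module. -/
theorem corA_proj : ∃ (n : ℕ) (τ : Cor G.iA L →ₗ[A] (Fin n → A)) (π : (Fin n → A) →ₗ[A] Cor G.iA L),
    ∀ x, π (τ x) = x := by
  have := G.fin
  have hfin : Module.Finite A (Cor G.iA L) := Module.Finite.of_restrictScalars_finite K A _
  obtain ⟨n, π, hπ⟩ := Module.Finite.exists_fin' A (Cor G.iA L)
  obtain ⟨τ, hτ⟩ := G.corA_split L 1 LinearMap.id (by simp) (Fin n → A) π hπ
  exact ⟨n, τ, π, hτ⟩

/-- The algebra `A` is a direct summand of the corner of the regular module. -/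
theorem corA_retract : ∃ (i : A →ₗ[A] Cor G.iA L) (r : Cor G.iA L →ₗ[A] A), ∀ x, r (i x) = x := by
  let φB : B →ₙₐ[K] A :=
    { toFun := fun y => G.χB y • G.ea
      map_smul' := by intro k y; simp [mul_smul]
      map_zero' := by simp
      map_add' := by intro x y; simp [add_smul]
      map_mul' := by intro x y; simp [G.ida, smul_smul, mul_comm] }
  have hφ : ∀ y, φB y = G.χB y • G.ea := fun _ => rfl
  obtain ⟨Φ, k1, k2⟩ := G.lift A (NonUnitalAlgHom.id K A) φB (by
    refine ⟨?_, ?_, ?_, ?_⟩ <;> simp [hφ, G.χeb])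
  refine ⟨{ toFun := fun x => ⟨G.iA x, by rw [Cor.mem_iff, smul_eq_mul, ← map_mul, one_mul]⟩,
            map_add' := by intro x y; apply Subtype.ext; simp
            map_smul' := by intro x y; apply Subtype.ext; simp },
          { toFun := fun x => Φ (x : L)
            map_add' := by intro x y; simp
            map_smul' := by intro x y; simp [k1] }, ?_⟩
  intro x
  simp [k1]

end GlueRing

end Abstract3

open CategoryTheory

section Abstract4

variable {K A B L : Type} [Field K] [Ring A] [Algebra K A] [Ring B] [Algebra K B]
    [Ring L] [Algebra K L]

namespace GlueRing

variable (G : GlueRing K A B L)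

theorem linOfGen {M N : Type} [AddCommGroup M] [Module L M] [Module K M] [IsScalarTower K L M]
    [AddCommGroup N] [Module L N] [Module K N] [IsScalarTower K L N] (F : M →ₗ[K] N)
    (h1 : ∀ x m, F (G.iA x • m) = G.iA x • F m)
    (h2 : ∀ x m, F (G.iB x • m) = G.iB x • F m) : ∃ F' : M →ₗ[L] N, ∀ m, F' m = F m :=
  ⟨{ toFun := F, map_add' := map_add F,
     map_smul' := G.gen_linear (Algebra.lsmul K K N) F h1 h2 }, fun _ => rfl⟩

theorem corExt {N X C : Type} [AddCommGroup N] [Module L N] [Module K N] [IsScalarTower K L N]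
    [AddCommGroup X] [Module L X] [Module K X] [IsScalarTower K L X]
    [AddCommGroup C] [Module L C] [Module K C] [IsScalarTower K L C]
    (hC : Module.Injective A (Cor G.iA C)) (f : N →ₗ[L] X) (hf : Function.Injective f)
    (g : N →ₗ[L] C) : ∃ GA : X →ₗ[K] C, (∀ a x, GA (G.iA a • x) = G.iA a • GA x) ∧
      (∀ x, G.iA 1 • GA x = GA x) ∧ ∀ n, GA (f n) = G.iA 1 • g n := by
  obtain ⟨gA, hgA⟩ := hC.out (Cor.map G.iA f) (Cor.map_inj G.iA f hf) (Cor.map G.iA g)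
  refine ⟨(Cor G.iA C).subtype ∘ₗ gA.restrictScalars K ∘ₗ Cor.proj G.iA X, ?_, ?_, ?_⟩
  · intro a x
    change ((gA (Cor.proj G.iA X (G.iA a • x)) : Cor G.iA C) : C) = _
    rw [projA_smul, map_smul]
    rfl
  · intro x
    exact (gA (Cor.proj G.iA X x)).2
  · intro n
    change ((gA (Cor.proj G.iA X (f n)) : Cor G.iA C) : C) = _
    have : Cor.proj G.iA X (f n) = Cor.map G.iA f (Cor.proj G.iA N n) := by
      apply Subtype.ext
      rw [Cor.coe_map, Cor.coe_proj, Cor.coe_proj, map_smul]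
    rw [this, hgA, Cor.coe_map, Cor.coe_proj, map_smul]

/-- The cocycle representation on `J × X`. -/
def twist {J X : Type} [AddCommGroup J] [Module L J] [Module K J] [IsScalarTower K L J]
    [AddCommGroup X] [Module L X] [Module K X] [IsScalarTower K L X] (f : A →ₙₐ[K] L)
    (D : X →ₗ[K] J) : A →ₙₐ[K] Module.End K (J × X) where
  toFun a :=
    { toFun := fun z => (f a • (z.1 + D z.2) - D (f a • z.2), f a • z.2)
      map_add' := by
        intro z w
        ext
        · simp only [Prod.fst_add, Prod.snd_add, smul_add, map_add]; abel
        · simp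
      map_smul' := by
        intro k z
        ext
        · simp [PBData.smulK, smul_sub]
        · simp [PBData.smulK] }
  map_smul' k x := by
    refine LinearMap.ext fun z => ?_
    ext <;> simp [smul_sub]
  map_zero' := by
    refine LinearMap.ext fun z => ?_
    ext <;> simp
  map_add' x y := by
    refine LinearMap.ext fun z => ?_
    ext
    · simp [add_smul]; abel
    · simp [add_smul]
  map_mul' x y := by
    refine LinearMap.ext fun z => ?_
    ext <;> simp [mul_smul, smul_sub]

theorem twist_apply {J X : Type} [AddCommGroup J] [Module L J] [Module K J] [IsScalarTower K L J]
    [AddCommGroup X] [Module L X] [Module K X] [IsScalarTower K L X] (f : A →ₙₐ[K] L)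
    (D : X →ₗ[K] J) (a : A) (z : J × X) :
    twist f D a z = (f a • (z.1 + D z.2) - D (f a • z.2), f a • z.2) := rfl

theorem inj_quot {J C : Type} [AddCommGroup J] [Module L J] [AddCommGroup C] [Module L C]
    [Module K J] [IsScalarTower K L J] [Module K C] [IsScalarTower K L C]
    (hJ : Module.Injective L J) (π : J →ₗ[L] C) (hπ : Function.Surjective π)
    (hA : Module.Injective A (Cor G.iA C)) (hB : Module.Injective B (Cor G.iB C)) :
    Module.Injective L C := by
  refine ⟨fun N X _ _ _ _ f hf g => ?_⟩
  let _ : Module K N := Module.compHom N (algebraMap K L)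
  have _ : IsScalarTower K L N := tower_compHom L N
  let _ : Module K X := Module.compHom X (algebraMap K L)
  have _ : IsScalarTower K L X := tower_compHom L X
  obtain ⟨GA, GA1, GA2, GA4⟩ := G.corExt hA f hf g
  obtain ⟨GB, GB1, GB2, GB4⟩ := G.swap.corExt hB f hf g
  change ∀ a x, GB (G.iB a • x) = G.iB a • GB x at GB1
  change ∀ x, G.iB 1 • GB x = GB x at GB2
  change ∀ n, GB (f n) = G.iB 1 • g n at GB4
  obtain ⟨s, hs⟩ := LinearMap.exists_rightInverse_of_surjective (π.restrictScalars K)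
    (LinearMap.range_eq_top.mpr hπ)
  have hs' : ∀ j, π (s j) = j := fun j => LinearMap.congr_fun hs j
  -- the idempotent
  have ee : G.iA G.ea * G.iA G.ea = G.iA G.ea := by rw [← map_mul, G.ida]
  have eeA : G.iA G.ea * G.iA 1 = G.iA G.ea := by rw [← map_mul, mul_one]
  have eAe : G.iA 1 * G.iA G.ea = G.iA G.ea := by rw [← map_mul, one_mul]
  have eeB : G.iA G.ea * G.iB 1 = G.iA G.ea := by rw [r1, ← map_mul, mul_one]
  have eBe : G.iB 1 * G.iA G.ea = G.iA G.ea := by rw [r1, ← map_mul, one_mul]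
  have GBe : ∀ x, GB (G.iA G.ea • x) = G.iA G.ea • GB x := by
    intro x; rw [r1, GB1]
  let D : X →ₗ[K] J :=
    { toFun := fun x => G.iA G.ea • s (G.iA G.ea • GA x - G.iA G.ea • GB x)
      map_add' := by
        intro x y
        rw [← smul_add, ← map_add s, map_add GA, map_add GB]
        congr 2
        rw [smul_add, smul_add]; abel
      map_smul' := by
        intro k x
        rw [map_smul GA, map_smul GB, PBData.smulK, PBData.smulK, ← smul_sub, map_smul s,
          PBData.smulK]; rfl }
  have hD : ∀ x, D x = G.iA G.ea • s (G.iA G.ea • GA x - G.iA G.ea • GB x) := fun _ => rfl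
  have πD : ∀ x, π (D x) = G.iA G.ea • GA x - G.iA G.ea • GB x := by
    intro x
    rw [hD, map_smul, hs', smul_sub, smul_smul, smul_smul, ee]
  have eD : ∀ x, G.iA G.ea • D x = D x := by
    intro x; rw [hD, smul_smul, ee]
  have De : ∀ x, D (G.iA G.ea • x) = D x := by
    intro x; rw [hD, hD, GA1, GBe, smul_smul, smul_smul, ee]
  have eBD : ∀ x, G.iB 1 • D x = D x := by
    intro x; rw [← eD, smul_smul, eBe]
  have DeB : ∀ x, D (G.iB 1 • x) = D x := by
    intro x; rw [← De, smul_smul, eeB, De]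
  have Df : ∀ n, D (f n) = 0 := by
    intro n
    rw [hD, GA4, GB4, smul_smul, smul_smul, eeA, eeB, sub_self, map_zero, smul_zero]
  have t0A : ∀ a (z : J × X), twist G.iA (0 : X →ₗ[K] J) a z = (G.iA a • z.1, G.iA a • z.2) := by
    intro a z; rw [twist_apply]; simp
  have tB1 : ∀ (z : J × X), twist G.iB D 1 z = (G.iB 1 • z.1, G.iB 1 • z.2) := by
    intro z; rw [twist_apply, DeB, smul_add, eBD, add_sub_cancel_right]
  have tBe : ∀ (z : J × X), twist G.iB D G.eb z = (G.iA G.ea • z.1, G.iA G.ea • z.2) := by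
    intro z; rw [twist_apply, ← r1, De, smul_add, eD, add_sub_cancel_right]
  have hrel : GlueRel G.ea G.eb (twist G.iA (0 : X →ₗ[K] J)) (twist G.iB D) := by
    refine ⟨?_, ?_, ?_, ?_⟩
    · refine LinearMap.ext fun z => ?_
      rw [t0A, tBe]
    · refine LinearMap.ext fun z => ?_
      rw [Module.End.mul_apply, tB1, t0A, t0A, smul_smul, smul_smul, r2]
    · refine LinearMap.ext fun z => ?_
      rw [Module.End.mul_apply, t0A, tB1, t0A, smul_smul, smul_smul, r3]
    · refine LinearMap.ext fun z => ?_
      rw [LinearMap.add_apply, LinearMap.add_apply, t0A, t0A, tB1, Prod.mk_add_mk, ← add_smul,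
        ← add_smul, r4, add_smul, add_smul, one_smul, one_smul]
      rfl
  obtain ⟨ρ, h1, h2, h3⟩ := G.retract hJ _ _ hrel (LinearMap.inl K J X) LinearMap.inl_injective
    (by intro x j; rw [t0A]; simp) (by intro x j; rw [twist_apply]; simp)
  have hρ : ∀ j x, ρ (j, x) = j + ρ (0, x) := by
    intro j x
    have : (j, x) = LinearMap.inl K J X j + (0, x) := by simp
    rw [this, map_add, h3]
  let h : X →ₗ[K] J := ρ ∘ₗ LinearMap.inr K J X
  have hh : ∀ x, h x = ρ (0, x) := fun _ => rfl
  have hhA : ∀ a x, h (G.iA a • x) = G.iA a • h x := by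
    intro a x
    rw [hh, hh, ← h1, t0A]; simp
  have hhB : ∀ b x, h (G.iB b • x) = G.iB b • h x - (G.iB b • D x - D (G.iB b • x)) := by
    intro b x
    rw [hh, hh, ← h2, twist_apply, hρ (_ - _)]; simp
  obtain ⟨hf', hhf'⟩ := G.linOfGen (h ∘ₗ f.restrictScalars K) (by
      intro x m
      simp [hhA]) (by
      intro x m
      simp only [LinearMap.comp_apply, LinearMap.coe_restrictScalars, map_smul f, hhB]
      rw [← map_smul f, Df, Df]; simp)
  obtain ⟨h', hh'⟩ := hJ.out f hf hf'
  have hk0 : ∀ n, h (f n) = h' (f n) := by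
    intro n; rw [hh', hhf']; rfl
  let F : X →ₗ[K] C := GA + GB - GB ∘ₗ (Algebra.lsmul K K X (G.iA G.ea))
     - (π.restrictScalars K) ∘ₗ (h - h'.restrictScalars K)
  have hF : ∀ x, F x = GA x + GB x - G.iA G.ea • GB x - (π (h x) - π (h' x)) := by
    intro x
    simp [F, GBe]
  obtain ⟨F', hF'⟩ := G.linOfGen F (by
      intro a x
      have e1 : G.iA G.ea • GB (G.iA a • x) = GB (G.iA a • x) := by
        rw [← GB2 (G.iA a • x), ← GB1, smul_smul (G.iB 1), G.iBA, map_mul, mul_smul, GBe,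
          smul_smul, ee]
      have e2 : G.iA a • GB x = G.iA a • G.iA G.ea • GB x := by
        rw [smul_smul, ← map_mul, ← G.iBA', mul_smul, GB2]
      rw [hF, hF, e1, GA1, hhA]
      simp only [smul_add, smul_sub, map_smul]
      rw [← e2]; abel) (by
      intro b x
      have e1 : G.iA G.ea • GA (G.iB b • x) = GA (G.iB b • x) := by
        rw [← GA2 (G.iB b • x), ← GA1, smul_smul (G.iA 1), G.iAB, map_mul, mul_smul, ← r1, GA1,
          smul_smul, ee]
      have e2 : G.iB b • GA x = G.iB b • G.iA G.ea • GA x := by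
        rw [smul_smul, r1, ← map_mul, ← G.iAB', mul_smul, GA2]
      rw [hF, hF, hhB]
      simp only [smul_add, smul_sub, map_smul, map_sub, πD, GB1]
      rw [← e2, e1]; abel)
  refine ⟨F', fun n => ?_⟩
  rw [hF', hF, GA4, GB4, hk0, sub_self, sub_zero, smul_smul, eeB, ← add_smul, r4, add_smul,
    one_smul, add_sub_cancel_right]

end GlueRing

end Abstract4

open CategoryTheory

section Abstract5

variable {K A B L : Type} [Field K] [Ring A] [Algebra K A] [Ring B] [Algebra K B]
    [Ring L] [Algebra K L]

namespace GlueRing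

/-- Short exact sequences starting an injective resolution. -/
theorem exists_ses (K L : Type) [Field K] [Ring L] [Algebra K L] (M : Type) [AddCommGroup M]
    [Module L M] : ∃ (I C : Type) (_ : AddCommGroup I) (_ : Module L I) (_ : Module K I)
      (_ : IsScalarTower K L I) (_ : AddCommGroup C) (_ : Module L C) (_ : Module K C)
      (_ : IsScalarTower K L C) (f : M →ₗ[L] I) (g : I →ₗ[L] C), Module.Injective L I ∧
      Function.Injective f ∧ Function.Surjective g ∧ Function.Exact f g := by
  obtain ⟨I, i1, i2, hI, f, hf⟩ := idim_exists_inj (R := L) M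
  exact ⟨I, I ⧸ LinearMap.range f, i1, i2, Module.compHom I (algebraMap K L), tower_compHom L I,
    inferInstance, inferInstance, Module.compHom _ (algebraMap K L), tower_compHom L _, f,
    (LinearMap.range f).mkQ, hI, hf, Submodule.mkQ_surjective _, LinearMap.exact_map_mkQ_range f⟩


theorem cor_idim (G : GlueRing K A B L) (n : ℕ) : ∀ (M : Type) [AddCommGroup M] [Module L M] [Module K M]
    [IsScalarTower K L M], HasInjDimLE L n M → HasInjDimLE A n (Cor G.iA M) := by
  induction n with
  | zero =>
    intro M _ _ _ _ h
    exact G.corA_inj M h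
  | succ n ih =>
    intro M _ _ _ _ h
    obtain ⟨I, C, _, _, _, _, _, _, _, _, f, g, hI, hf, hg, hfg⟩ := exists_ses K L M
    have h' := ih C ((idim_ses f g hf hg hfg hI n).mpr h)
    exact (idim_ses (Cor.map G.iA f) (Cor.map G.iA g) (Cor.map_inj _ f hf) (Cor.map_surj _ g hg)
      (Cor.map_exact _ f g hfg) (G.corA_inj I hI) n).mp h'

theorem upper (G : GlueRing K A B L) (n : ℕ) : ∀ (M : Type) [AddCommGroup M] [Module L M] [Module K M]
    [IsScalarTower K L M], HasInjDimLE A (n + 1) (Cor G.iA M) → HasInjDimLE B (n + 1) (Cor G.iB M) →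
      HasInjDimLE L (n + 1) M := by
  induction n with
  | zero =>
    intro M _ _ _ _ h h2
    obtain ⟨I, C, _, _, _, _, _, _, _, _, f, g, hI, hf, hg, hfg⟩ := exists_ses K L M
    have hA : HasInjDimLE A 0 (Cor G.iA C) :=
      (idim_ses (Cor.map G.iA f) (Cor.map G.iA g) (Cor.map_inj _ f hf)
      (Cor.map_surj _ g hg) (Cor.map_exact _ f g hfg) (G.corA_inj I hI) 0).mpr h
    have hB : HasInjDimLE B 0 (Cor G.iB C) :=
      (idim_ses (Cor.map G.iB f) (Cor.map G.iB g) (Cor.map_inj _ f hf)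
      (Cor.map_surj _ g hg) (Cor.map_exact _ f g hfg) (G.swap.corA_inj I hI) 0).mpr h2
    exact (idim_ses f g hf hg hfg hI 0).mp (G.inj_quot hI g hg hA hB)
  | succ n ih =>
    intro M _ _ _ _ h h2
    obtain ⟨I, C, _, _, _, _, _, _, _, _, f, g, hI, hf, hg, hfg⟩ := exists_ses K L M
    have hA :=
      (idim_ses (Cor.map G.iA f) (Cor.map G.iA g) (Cor.map_inj _ f hf)
      (Cor.map_surj _ g hg) (Cor.map_exact _ f g hfg) (G.corA_inj I hI) (n + 1)).mpr h
    have hB :=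
      (idim_ses (Cor.map G.iB f) (Cor.map G.iB g) (Cor.map_inj _ f hf)
      (Cor.map_surj _ g hg) (Cor.map_exact _ f g hfg) (G.swap.corA_inj I hI) (n + 1)).mpr h2
    exact (idim_ses f g hf hg hfg hI (n + 1)).mp (ih C hA hB)

theorem T1 (G : GlueRing K A B L) {n : ℕ} (h : HasInjDimLE L n L) : HasInjDimLE A n A := by
  obtain ⟨i, r, hr⟩ := G.corA_retract
  exact idim_retract i r hr (G.cor_idim n L h)

theorem corL (G : GlueRing K A B L) {n : ℕ} (h : HasInjDimLE A n A) : HasInjDimLE A n (Cor G.iA L) := by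
  obtain ⟨m, τ, π, hr⟩ := G.corA_proj
  exact idim_retract τ π hr (idim_pi n A h)

theorem T2 (G : GlueRing K A B L) {n : ℕ} (h : HasInjDimLE A n A) (h2 : HasInjDimLE B n B) :
    HasInjDimLE L (max n 1) L := by
  obtain ⟨m, hm⟩ : ∃ m, max n 1 = m + 1 := ⟨max n 1 - 1, by omega⟩
  rw [hm]
  have hn : n ≤ m + 1 := by omega
  exact G.upper m L (idim_mono hn (G.corL h)) (idim_mono hn (G.swap.corL h2))

theorem final (G : GlueRing K A B L) : (IwanagaGorenstein L ↔ (IwanagaGorenstein A ∧ IwanagaGorenstein B)) ∧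
    (IwanagaGorenstein L → max (gorensteinDim A) (gorensteinDim B) ≤ gorensteinDim L ∧
      gorensteinDim L ≤ max (max (gorensteinDim A) (gorensteinDim B)) 1) := by
  have key : ∀ (R : Type) [Ring R], IwanagaGorenstein R →
      HasInjDimLE R (gorensteinDim R) R ∧ HasInjDimLE Rᵐᵒᵖ (gorensteinDim R) Rᵐᵒᵖ := by
    intro R _ ⟨⟨n, hn⟩, m, hm⟩
    exact Nat.sInf_mem (s := {d | HasInjDimLE R d R ∧ HasInjDimLE Rᵐᵒᵖ d Rᵐᵒᵖ})
      ⟨max n m, idim_mono (le_max_left _ _) hn, idim_mono (le_max_right _ _) hm⟩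
  have fwd : IwanagaGorenstein L → IwanagaGorenstein A ∧ IwanagaGorenstein B := by
    rintro ⟨⟨n, hn⟩, m, hm⟩
    exact ⟨⟨⟨n, G.T1 hn⟩, m, G.op.T1 hm⟩, ⟨n, G.swap.T1 hn⟩, m, G.op.swap.T1 hm⟩
  refine ⟨⟨fwd, ?_⟩, ?_⟩
  · rintro ⟨hA, hB⟩
    have h1 := key A hA
    have h2 := key B hB
    have l1 := le_max_left (gorensteinDim A) (gorensteinDim B)
    have l2 := le_max_right (gorensteinDim A) (gorensteinDim B)
    exact ⟨⟨_, G.T2 (idim_mono l1 h1.1) (idim_mono l2 h2.1)⟩,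
      ⟨_, G.op.T2 (idim_mono l1 h1.2) (idim_mono l2 h2.2)⟩⟩
  · intro hL
    obtain ⟨hA, hB⟩ := fwd hL
    have h0 := key L hL
    have h1 := key A hA
    have h2 := key B hB
    have l1 := le_max_left (gorensteinDim A) (gorensteinDim B)
    have l2 := le_max_right (gorensteinDim A) (gorensteinDim B)
    refine ⟨max_le ?_ ?_, ?_⟩
    · exact Nat.sInf_le ⟨G.T1 h0.1, G.op.T1 h0.2⟩
    · exact Nat.sInf_le ⟨G.swap.T1 h0.1, G.op.swap.T1 h0.2⟩
    · exact Nat.sInf_le ⟨G.T2 (idim_mono l1 h1.1) (idim_mono l2 h2.1),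
        G.op.T2 (idim_mono l1 h1.2) (idim_mono l2 h2.2)⟩

end GlueRing

end Abstract5

open CategoryTheory

section PathAlgebra

variable (K : Type) [Field K] (Q : BQuiver)

/-- A path as an element of the index set of paths. -/
def pidx {Q : BQuiver} {i j : Q.V} (p : Quiver.Path i j) : PIdx Q := ⟨i, j, p⟩

/-- A basis vector of the free module on paths. -/
noncomputable def pm {i j : Q.V} (p : Quiver.Path i j) : PMod K Q :=
  (Finsupp.single (pidx p) (1 : K) : PIdx Q →₀ K)

variable {K Q}

theorem Lop_pm {i j k : Q.V} (q : Quiver.Path i j) (p : Quiver.Path j k) :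
    Lop K Q p (pm K Q q) = pm K Q (q.comp p) := by
  have h : Lop K Q p (pm K Q q) = _ :=
    Finsupp.lsum_single (S := K) (M := K) (N := PMod K Q) _ (pidx q) (1 : K)
  exact h.trans (congrFun (congrArg DFunLike.coe (dif_pos rfl)) 1)

theorem Lop_pm_ne {i j j' k : Q.V} (q : Quiver.Path i j) (p : Quiver.Path j' k) (hj : j ≠ j') :
    Lop K Q p (pm K Q q) = 0 := by
  have h : Lop K Q p (pm K Q q) = _ :=
    Finsupp.lsum_single (S := K) (M := K) (N := PMod K Q) _ (pidx q) (1 : K)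
  exact h.trans (congrFun (congrArg DFunLike.coe (dif_neg hj)) 1)

theorem pm_ext {f g : Module.End K (PMod K Q)}
    (h : ∀ (i j : Q.V) (p : Quiver.Path i j), f (pm K Q p) = g (pm K Q p)) : f = g := by
  apply Finsupp.lhom_ext' (M := K) (R := K) (α := PIdx Q) (N := PMod K Q)
  rintro ⟨i, j, p⟩
  apply LinearMap.ext_ring
  exact h i j p

theorem Lop_mul {i j k : Q.V} (q : Quiver.Path i j) (p : Quiver.Path j k) :
    Lop K Q p * Lop K Q q = Lop K Q (q.comp p) := by
  apply pm_ext
  intro i' j' r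
  rw [Module.End.mul_apply]
  by_cases h : j' = i
  · subst h
    rw [Lop_pm, Lop_pm, Lop_pm, Quiver.Path.comp_assoc]
  · rw [Lop_pm_ne _ _ h, Lop_pm_ne _ _ h, map_zero]

theorem Lop_mul_ne {i j j' k : Q.V} (q : Quiver.Path i j) (p : Quiver.Path j' k) (hj : j ≠ j') :
    Lop K Q p * Lop K Q q = 0 := by
  apply pm_ext
  intro i' j'' r
  rw [Module.End.mul_apply]
  by_cases h : j'' = i
  · subst h
    rw [Lop_pm, Lop_pm_ne _ _ hj]; rfl
  · rw [Lop_pm_ne _ _ h, map_zero]; rfl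

theorem pathEl_mul {i j k : Q.V} (q : Quiver.Path i j) (p : Quiver.Path j k) :
    pathEl K Q p * pathEl K Q q = pathEl K Q (q.comp p) := Subtype.ext (Lop_mul q p)

theorem pathEl_mul_ne {i j j' k : Q.V} (q : Quiver.Path i j) (p : Quiver.Path j' k) (hj : j ≠ j') :
    pathEl K Q p * pathEl K Q q = 0 := Subtype.ext (Lop_mul_ne q p hj)

theorem sum_nil : ∑ i : Q.V, pathEl K Q (Quiver.Path.nil : Quiver.Path i i) = 1 := by
  apply Subtype.ext
  apply pm_ext
  intro i j p
  rw [AddSubmonoidClass.coe_finset_sum, LinearMap.sum_apply, Finset.sum_eq_single j]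
  · exact Lop_pm p _
  · intro k _ hk
    exact Lop_pm_ne p _ (Ne.symm hk)
  · intro h
    exact absurd (Finset.mem_univ _) h

variable (K Q) in
/-- Evaluation of formal linear combinations, as a linear map. -/
noncomputable def evalLin : (PIdx Q →₀ K) →ₗ[K] PathAlg K Q where
  toFun := evalPA K Q
  map_add' x y := Subtype.ext (map_add (evalEnd K Q) x y)
  map_smul' k x := Subtype.ext (map_smul (evalEnd K Q) k x)

theorem evalLin_single (q : PIdx Q) (k : K) :
    evalLin K Q (Finsupp.single q k) = k • pathEl K Q q.2.2 := by
  apply Subtype.ext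
  change evalEnd K Q (Finsupp.single q k) = k • Lop K Q q.2.2
  rw [evalEnd, Finsupp.lsum_single, LinearMap.toSpanSingleton_apply]

theorem evalLin_pidx {i j : Q.V} (p : Quiver.Path i j) :
    evalLin K Q (Finsupp.single (pidx p) 1) = pathEl K Q p := by
  have := evalLin_single (K := K) (pidx p) 1
  rw [one_smul] at this
  exact this

theorem evalLin_inj : Function.Injective (evalLin K Q) := by
  let v : PathAlg K Q →ₗ[K] PMod K Q :=
    (LinearMap.applyₗ (∑ i : Q.V, pm K Q (Quiver.Path.nil : Quiver.Path i i))) ∘ₗ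
      (PathAlg K Q).val.toLinearMap
  have h : v ∘ₗ evalLin K Q = LinearMap.id (M := PIdx Q →₀ K) := by
    apply Finsupp.lhom_ext'
    rintro ⟨i, j, p⟩
    apply LinearMap.ext_ring
    change v (evalLin K Q (Finsupp.single (pidx p) 1)) = pm K Q p
    rw [evalLin_pidx]
    change Lop K Q p (∑ i : Q.V, pm K Q (Quiver.Path.nil : Quiver.Path i i)) = _
    rw [map_sum, Finset.sum_eq_single i]
    · rw [Lop_pm, Quiver.Path.nil_comp]
    · intro k _ hk
      exact Lop_pm_ne _ p hk
    · intro h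
      exact absurd (Finset.mem_univ _) h
  intro x y hxy
  have := congrArg v hxy
  have e : ∀ x, v (evalLin K Q x) = x := fun x => LinearMap.congr_fun h x
  exact (e x).symm.trans (this.trans (e y))

theorem pa_induction {P : PathAlg K Q → Prop} (h0 : P 0)
    (hp : ∀ (i j : Q.V) (p : Quiver.Path i j), P (pathEl K Q p))
    (hadd : ∀ x y, P x → P y → P (x + y)) (hsmul : ∀ (k : K) x, P x → P (k • x))
    (x : PathAlg K Q) : P x := by
  have hmem : ∀ f (hf : f ∈ Algebra.adjoin K
      {f | ∃ (i j : Q.V) (p : Quiver.Path i j), f = Lop K Q p}),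
      (⟨f, hf⟩ : PathAlg K Q) ∈ Submodule.span K
        (Set.range fun q : PIdx Q => pathEl K Q q.2.2) := by
    intro f hf
    induction hf using Algebra.adjoin_induction with
    | mem x hx =>
      obtain ⟨i, j, p, rfl⟩ := hx
      exact Submodule.subset_span ⟨⟨i, j, p⟩, rfl⟩
    | algebraMap r =>
      have : (⟨algebraMap K _ r, Subalgebra.algebraMap_mem _ r⟩ : PathAlg K Q) =
        r • ∑ i : Q.V, pathEl K Q (Quiver.Path.nil : Quiver.Path i i) := by
        rw [sum_nil]
        apply Subtype.ext
        change algebraMap K _ r = r • 1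
        rw [Algebra.algebraMap_eq_smul_one]
      rw [this]
      exact Submodule.smul_mem _ _ (Submodule.sum_mem _ fun i _ =>
        Submodule.subset_span ⟨⟨i, i, Quiver.Path.nil⟩, rfl⟩)
    | add x y hx hy h1 h2 => exact Submodule.add_mem _ h1 h2
    | mul x y hx hy h1 h2 =>
      have h3 := Submodule.mul_mem_mul h1 h2
      rw [Submodule.span_mul_span] at h3
      refine Submodule.span_le.mpr ?_ h3
      rintro _ ⟨_, ⟨⟨i, j, p⟩, rfl⟩, _, ⟨⟨i', j', p'⟩, rfl⟩, rfl⟩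
      by_cases h : j' = i
      · subst h
        exact Submodule.subset_span ⟨⟨i', j, p'.comp p⟩, (pathEl_mul p' p).symm⟩
      · change pathEl K Q p * pathEl K Q p' ∈ _
        rw [pathEl_mul_ne p' p h]
        exact Submodule.zero_mem _
  have hx := hmem x.1 x.2
  change x ∈ _ at hx
  induction hx using Submodule.span_induction with
  | mem x hx =>
    obtain ⟨q, rfl⟩ := hx
    exact hp _ _ _
  | zero => exact h0
  | add x y _ _ h1 h2 => exact hadd x y h1 h2
  | smul k x _ h => exact hsmul k x h

theorem evalLin_surj : Function.Surjective (evalLin K Q) := by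
  intro x
  induction x using pa_induction with
  | h0 => exact ⟨0, map_zero _⟩
  | hp i j p => exact ⟨Finsupp.single (pidx p) 1, evalLin_pidx p⟩
  | hadd x y hx hy =>
    obtain ⟨a, rfl⟩ := hx
    obtain ⟨b, rfl⟩ := hy
    exact ⟨a + b, map_add _ _ _⟩
  | hsmul k x hx =>
    obtain ⟨a, rfl⟩ := hx
    exact ⟨k • a, map_smul _ _ _⟩

variable (K Q) in
/-- Paths form a basis of the path algebra. -/
noncomputable def paEquiv : (PIdx Q →₀ K) ≃ₗ[K] PathAlg K Q :=
  LinearEquiv.ofBijective (evalLin K Q) ⟨evalLin_inj, evalLin_surj⟩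

/-- A representation of the quiver inside a ring. -/
structure QRep (Q : BQuiver) (E : Type) [Ring E] where
  ε : Q.V → E
  α : Q.Arr → E
  idem : ∀ i, ε i * ε i = ε i
  orth : ∀ i j, i ≠ j → ε i * ε j = 0
  tα : ∀ e, ε (Q.t e) * α e = α e
  αs : ∀ e, α e * ε (Q.s e) = α e

namespace QRep

variable {E : Type} [Ring E] (R : QRep Q E)

/-- The value of a representation on a path. -/
def onPath {i : Q.V} : ∀ {j : Q.V}, Quiver.Path i j → E
  | _, Quiver.Path.nil => R.ε i
  | _, Quiver.Path.cons p e => R.α e.1 * onPath p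

theorem onPath_nil (i : Q.V) : R.onPath (Quiver.Path.nil : Quiver.Path i i) = R.ε i := rfl

theorem onPath_cons {i j k : Q.V} (p : Quiver.Path i j) (e : j ⟶ k) :
    R.onPath (p.cons e) = R.α e.1 * R.onPath p := rfl

theorem ε_onPath {i j : Q.V} (p : Quiver.Path i j) : R.ε j * R.onPath p = R.onPath p := by
  cases p with
  | nil => exact R.idem _
  | cons p e =>
    obtain ⟨e, rfl, rfl⟩ := e
    rw [onPath_cons, ← mul_assoc, R.tα]

theorem onPath_ε {i j : Q.V} (p : Quiver.Path i j) : R.onPath p * R.ε i = R.onPath p := by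
  induction p with
  | nil => exact R.idem _
  | cons p e ih => rw [onPath_cons, mul_assoc, ih]

theorem onPath_comp {i j k : Q.V} (q : Quiver.Path i j) (p : Quiver.Path j k) :
    R.onPath (q.comp p) = R.onPath p * R.onPath q := by
  induction p with
  | nil => rw [Quiver.Path.comp_nil, onPath_nil, ε_onPath]
  | cons p e ih => rw [Quiver.Path.comp_cons, onPath_cons, onPath_cons, ih, mul_assoc]

theorem onPath_ne {i j j' k : Q.V} (q : Quiver.Path i j) (p : Quiver.Path j' k) (hj : j ≠ j') :
    R.onPath p * R.onPath q = 0 := by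
  rw [← R.onPath_ε p, ← R.ε_onPath q, mul_assoc, ← mul_assoc (R.ε j'), R.orth _ _ hj.symm, zero_mul,
    mul_zero]

variable [Algebra K E]

variable (K) in
/-- The linear map from the path algebra induced by a representation. -/
noncomputable def lin : PathAlg K Q →ₗ[K] E :=
  (Finsupp.lsum K fun q : PIdx Q => LinearMap.toSpanSingleton K E (R.onPath q.2.2)) ∘ₗ
    (paEquiv K Q).symm.toLinearMap

theorem lin_evalPA (x : PIdx Q →₀ K) : R.lin K (evalPA K Q x) =
    x.sum fun q k => k • R.onPath q.2.2 := by
  have : evalPA K Q x = paEquiv K Q x := rfl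
  rw [lin, LinearMap.comp_apply, this]
  simp [Finsupp.lsum_apply, Finsupp.sum, LinearMap.toSpanSingleton_apply]

theorem lin_path {i j : Q.V} (p : Quiver.Path i j) : R.lin K (pathEl K Q p) = R.onPath p := by
  have h : pathEl K Q p = evalPA K Q (Finsupp.single (pidx p) 1) := (evalLin_pidx p).symm
  rw [h, lin_evalPA]
  exact (Finsupp.sum_single_index (h := fun (q : PIdx Q) (k : K) => k • R.onPath q.2.2)
    (zero_smul _ _)).trans (one_smul _ _)

theorem lin_mul (x y : PathAlg K Q) : R.lin K (x * y) = R.lin K x * R.lin K y := by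
  induction x using pa_induction with
  | h0 => simp
  | hadd x x' hx hx' => rw [add_mul, map_add, map_add, add_mul, hx, hx']
  | hsmul k x hx => rw [smul_mul_assoc, map_smul, map_smul, smul_mul_assoc, hx]
  | hp i j p =>
    induction y using pa_induction with
    | h0 => simp
    | hadd x x' hx hx' => rw [mul_add, map_add, map_add, mul_add, hx, hx']
    | hsmul k x hx => rw [mul_smul_comm, map_smul, map_smul, mul_smul_comm, hx]
    | hp i' j' q =>
      by_cases h : j' = i
      · subst h
        rw [pathEl_mul, lin_path, lin_path, lin_path, onPath_comp]
      · rw [pathEl_mul_ne _ _ h, map_zero, lin_path, lin_path, onPath_ne _ _ _ h]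

variable (K) in
/-- The non-unital algebra map induced by a representation. -/
noncomputable def hom : PathAlg K Q →ₙₐ[K] E where
  toFun := R.lin K
  map_smul' := map_smul (R.lin K)
  map_zero' := map_zero (R.lin K)
  map_add' := map_add (R.lin K)
  map_mul' := R.lin_mul

theorem hom_path {i j : Q.V} (p : Quiver.Path i j) : R.hom K (pathEl K Q p) = R.onPath p :=
  R.lin_path p

theorem hom_evalPA (x : PIdx Q →₀ K) : R.hom K (evalPA K Q x) =
    x.sum fun q k => k • R.onPath q.2.2 := R.lin_evalPA x

theorem hom_one : R.hom K 1 = ∑ i, R.ε i := by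
  rw [← sum_nil, map_sum]
  exact Finset.sum_congr rfl fun i _ => R.hom_path _

end QRep

end PathAlgebra

open CategoryTheory

section BQ

variable {K : Type} [Field K] {Q : BQuiver}

noncomputable instance BQAlg.instAlgebra (I : TwoSidedIdeal (PathAlg K Q)) :
    Algebra K (BQAlg K Q I) :=
  inferInstanceAs (Algebra K I.ringCon.Quotient)

variable (I : TwoSidedIdeal (PathAlg K Q))

theorem BQmk_surj : Function.Surjective (BQmk K Q I) := RingCon.mk'_surjective (c := I.ringCon)

theorem BQmk_smul (k : K) (x : PathAlg K Q) : BQmk K Q I (k • x) = k • BQmk K Q I x := rfl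

theorem BQmk_eq_zero (x : PathAlg K Q) : BQmk K Q I x = 0 ↔ x ∈ I := by
  rw [TwoSidedIdeal.mem_iff]
  exact Quotient.eq''

/-- The quotient map as a non-unital algebra map. -/
noncomputable def BQmkHom : PathAlg K Q →ₐ[K] BQAlg K Q I :=
  { BQmk K Q I with
    commutes' := fun k => by
      rw [Algebra.algebraMap_eq_smul_one, Algebra.algebraMap_eq_smul_one]
      change BQmk K Q I (k • 1) = _
      rw [BQmk_smul, map_one] }

variable {I}

/-- Non-unital algebra maps out of the bound quiver algebra. -/
noncomputable def BQlift {E : Type} [Ring E] [Algebra K E] (φ : PathAlg K Q →ₙₐ[K] E)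
    (h : ∀ x ∈ I, φ x = 0) : BQAlg K Q I →ₙₐ[K] E :=
  have key : ∀ x y, BQmk K Q I x = BQmk K Q I y → φ x = φ y := by
    intro x y hxy
    rw [← sub_eq_zero, ← map_sub, BQmk_eq_zero] at hxy
    have := h _ hxy
    rwa [map_sub, sub_eq_zero] at this
  have s : ∀ z, BQmk K Q I (Function.surjInv (BQmk_surj I) z) = z :=
    Function.surjInv_eq (BQmk_surj I)
  { toFun := fun z => φ (Function.surjInv (BQmk_surj I) z)
    map_smul' := fun k z => by
      rw [← map_smul]
      apply key
      rw [s]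
      change _ = BQmk K Q I (k • _)
      rw [BQmk_smul, s]
    map_zero' := by
      rw [← map_zero φ]
      apply key
      rw [s, map_zero]
    map_add' := fun x y => by
      rw [← map_add]
      apply key
      rw [s, map_add, s, s]
    map_mul' := fun x y => by
      rw [← map_mul]
      apply key
      rw [s, map_mul, s, s] }

theorem BQlift_mk {E : Type} [Ring E] [Algebra K E] (φ : PathAlg K Q →ₙₐ[K] E)
    (h : ∀ x ∈ I, φ x = 0) (x : PathAlg K Q) : BQlift φ h (BQmk K Q I x) = φ x := by
  have s : BQmk K Q I (Function.surjInv (BQmk_surj I) (BQmk K Q I x)) = BQmk K Q I x :=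
    Function.surjInv_eq (BQmk_surj I) _
  change φ (Function.surjInv (BQmk_surj I) (BQmk K Q I x)) = φ x
  rw [← sub_eq_zero, ← map_sub, BQmk_eq_zero] at s
  have := h _ s
  rwa [map_sub, sub_eq_zero] at this

theorem kills {E : Type} [Ring E] [Algebra K E] (φ : PathAlg K Q →ₙₐ[K] E)
    (R : Set (PIdx Q →₀ K)) (h : ∀ r ∈ R, φ (evalPA K Q r) = 0) :
    ∀ x ∈ relIdeal K Q R, φ x = 0 := by
  have : relIdeal K Q R ≤ TwoSidedIdeal.ker φ := by
    rw [relIdeal, TwoSidedIdeal.span_le]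
    rintro _ ⟨r, hr, rfl⟩
    rw [SetLike.mem_coe, TwoSidedIdeal.mem_ker]
    exact h r hr
  intro x hx
  exact (TwoSidedIdeal.mem_ker _).mp (this hx)

/-- The class of a path in the bound quiver algebra. -/
noncomputable def bp (I : TwoSidedIdeal (PathAlg K Q)) {i j : Q.V} (p : Quiver.Path i j) :
    BQAlg K Q I := BQmk K Q I (pathEl K Q p)

theorem bp_mul {i j k : Q.V} (q : Quiver.Path i j) (p : Quiver.Path j k) :
    bp I p * bp I q = bp I (q.comp p) := by
  rw [bp, bp, ← map_mul, pathEl_mul]; rfl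

theorem bp_mul_ne {i j j' k : Q.V} (q : Quiver.Path i j) (p : Quiver.Path j' k) (hj : j ≠ j') :
    bp I p * bp I q = 0 := by
  rw [bp, bp, ← map_mul, pathEl_mul_ne _ _ hj, map_zero]

/-- The class of an arrow. -/
noncomputable def ba (I : TwoSidedIdeal (PathAlg K Q)) (e : Q.Arr) : BQAlg K Q I :=
  bp I (Quiver.Hom.toPath (⟨e, rfl, rfl⟩ : Q.s e ⟶ Q.t e))

/-- The class of a vertex. -/
noncomputable def bv (I : TwoSidedIdeal (PathAlg K Q)) (i : Q.V) : BQAlg K Q I :=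
  bp I (Quiver.Path.nil : Quiver.Path i i)

theorem bv_idem (i : Q.V) : bv I i * bv I i = bv I i := bp_mul _ _

theorem bv_orth (i j : Q.V) (h : i ≠ j) : bv I i * bv I j = 0 := bp_mul_ne _ _ h.symm

theorem bv_sum : ∑ i, bv I i = 1 := by
  rw [← map_one (BQmk K Q I), ← sum_nil, map_sum]; rfl

theorem bv_ba (e : Q.Arr) : bv I (Q.t e) * ba I e = ba I e := bp_mul _ _

theorem ba_bv (e : Q.Arr) : ba I e * bv I (Q.s e) = ba I e := by
  rw [ba, bv, bp_mul, Quiver.Path.nil_comp]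

theorem bp_cons {i j k : Q.V} (p : Quiver.Path i j) (e : j ⟶ k) :
    bp I (p.cons e) = ba I e.1 * bp I p := by
  obtain ⟨e, rfl, rfl⟩ := e
  rw [ba, bp_mul]; rfl

theorem bq_induction {P : BQAlg K Q I → Prop} (h0 : P 0)
    (hp : ∀ (i j : Q.V) (p : Quiver.Path i j), P (bp I p))
    (hadd : ∀ x y, P x → P y → P (x + y)) (hsmul : ∀ (k : K) x, P x → P (k • x))
    (x : BQAlg K Q I) : P x := by
  obtain ⟨x, rfl⟩ := BQmk_surj I x
  induction x using pa_induction with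
  | h0 => rwa [map_zero]
  | hp i j p => exact hp i j p
  | hadd x y hx hy => rw [map_add]; exact hadd _ _ hx hy
  | hsmul k x hx => rw [BQmk_smul]; exact hsmul _ _ hx

theorem bq_fin (h : FiniteDimensional K (BQAlgModK K Q I)) : FiniteDimensional K (BQAlg K Q I) := by
  let f : BQAlgModK K Q I →ₗ[K] BQAlg K Q I :=
    Submodule.liftQ (Submodule.restrictScalars K (TwoSidedIdeal.asIdeal I))
      (BQmkHom I).toLinearMap (by
        intro x hx
        rw [LinearMap.mem_ker]
        exact (BQmk_eq_zero I x).mpr hx)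
  have hf : Function.Surjective f := by
    intro y
    obtain ⟨x, rfl⟩ := BQmk_surj I y
    exact ⟨Submodule.Quotient.mk x, Submodule.liftQ_apply _ _ _⟩
  exact Module.Finite.of_surjective f hf

end BQ

section Chi

variable {K : Type} [Field K] {Q : BQuiver}

/-- The representation concentrated at a vertex. -/
def simpleRep (K : Type) [Field K] (Q : BQuiver) (a : Q.V) : QRep Q K where
  ε i := if i = a then 1 else 0
  α _ := 0
  idem i := by split <;> simp
  orth i j h := by
    by_cases h1 : i = a
    · have : j ≠ a := fun h2 => h (h1.trans h2.symm)
      simp [this]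
    · simp [h1]
  tα e := by simp
  αs e := by simp

theorem simpleRep_pos (a : Q.V) {i j : Q.V} (p : Quiver.Path i j) (h : 1 ≤ p.length) :
    (simpleRep K Q a).onPath p = 0 := by
  cases p with
  | nil => simp at h
  | cons p e => exact zero_mul _

theorem simpleRep_kills (a : Q.V) (I : TwoSidedIdeal (PathAlg K Q)) (hI : IsAdmissible K Q I) :
    ∀ x ∈ I, (simpleRep K Q a).hom K x = 0 := by
  intro x hx
  have h := hI.2 x hx
  let S : Submodule K (PathAlg K Q) := Submodule.span K {f | ∃ (i j : Q.V) (p : Quiver.Path i j),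
        2 ≤ p.length ∧ f = pathEl K Q p}
  have hS : Submodule.span K {f | ∃ (i j : Q.V) (p : Quiver.Path i j),
        2 ≤ p.length ∧ f = Lop K Q p} ≤ S.map (PathAlg K Q).val.toLinearMap := by
    rw [Submodule.span_le]
    rintro _ ⟨i, j, p, hp, rfl⟩
    exact ⟨pathEl K Q p, Submodule.subset_span ⟨i, j, p, hp, rfl⟩, rfl⟩
  obtain ⟨y, hy, hyx⟩ := hS h
  have hyx' : y = x := Subtype.ext hyx
  subst hyx'
  have hle : S ≤ LinearMap.ker ((simpleRep K Q a).lin K) := by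
    rw [Submodule.span_le]
    rintro _ ⟨i, j, p, hp, rfl⟩
    rw [SetLike.mem_coe, LinearMap.mem_ker, QRep.lin_path]
    exact simpleRep_pos a p (by omega)
  exact hle hy

/-- The character of the bound quiver algebra at a vertex. -/
noncomputable def chi (a : Q.V) (I : TwoSidedIdeal (PathAlg K Q)) (hI : IsAdmissible K Q I) :
    BQAlg K Q I →ₐ[K] K :=
  have h1 : BQlift _ (simpleRep_kills a I hI) 1 = 1 := by
    rw [← map_one (BQmk K Q I), BQlift_mk, QRep.hom_one]
    simp [simpleRep]
  { BQlift _ (simpleRep_kills a I hI) with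
    map_one' := h1
    commutes' := fun k => by
      rw [Algebra.algebraMap_eq_smul_one]
      change BQlift _ (simpleRep_kills a I hI) (k • 1) = _
      rw [map_smul, h1]
      simp }

theorem chi_bp (a : Q.V) (I : TwoSidedIdeal (PathAlg K Q)) (hI : IsAdmissible K Q I) {i j : Q.V}
    (p : Quiver.Path i j) : chi a I hI (bp I p) = (simpleRep K Q a).onPath p := by
  change BQlift _ (simpleRep_kills a I hI) (BQmk K Q I _) = _
  rw [BQlift_mk, QRep.hom_path]

theorem chi_bv (a : Q.V) (I : TwoSidedIdeal (PathAlg K Q)) (hI : IsAdmissible K Q I) :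
    chi a I hI (bv I a) = 1 := by
  rw [bv, chi_bp]
  simp [QRep.onPath_nil, simpleRep]

theorem corner_scalar (a : Q.V) (I : TwoSidedIdeal (PathAlg K Q)) (hI : IsAdmissible K Q I)
    (hc : ∀ p : Quiver.Path a a, p ≠ Quiver.Path.nil → pathEl K Q p ∈ I) (x : BQAlg K Q I) :
    bv I a * x * bv I a = chi a I hI x • bv I a := by
  induction x using bq_induction with
  | h0 => simp
  | hadd x y hx hy => rw [mul_add, add_mul, hx, hy, map_add, add_smul]
  | hsmul k x hx => rw [mul_smul_comm, smul_mul_assoc, hx, map_smul, smul_eq_mul, mul_smul]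
  | hp i j p =>
    by_cases hj : j = a
    · subst hj
      by_cases hi : i = j
      · subst hi
        have e : bv I i * bp I p * bv I i = bp I p := by
          rw [bv, bp_mul, bp_mul, Quiver.Path.nil_comp, Quiver.Path.comp_nil]
        rw [e]
        by_cases hp : p = Quiver.Path.nil
        · subst hp
          change bv I i = chi i I hI (bv I i) • _
          rw [chi_bv, one_smul]
        · have h0 : bp I p = 0 := (BQmk_eq_zero I _).mpr (hc p hp)
          rw [h0, map_zero, zero_smul]
      · have e : bp I p * bv I j = 0 := bp_mul_ne _ _ (Ne.symm hi)
        rw [mul_assoc, e, mul_zero]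
        have h2 : chi j I hI (bp I p * bv I j) = 0 := by rw [e, map_zero]
        rw [map_mul, chi_bv, mul_one] at h2
        rw [h2, zero_smul]
    · have e : bv I a * bp I p = 0 := bp_mul_ne _ _ hj
      rw [e, zero_mul]
      have h2 : chi a I hI (bv I a * bp I p) = 0 := by rw [e, map_zero]
      rw [map_mul, chi_bv, one_mul] at h2
      rw [h2, zero_smul]

end Chi

open CategoryTheory

section Pull

variable {K : Type} [Field K] {Q Q' : BQuiver} {E : Type} [Ring E]

/-- Pulling back a representation along a map of quivers that is injective on vertices. -/
def QRep.pull (R : QRep Q' E) (F : Q.V ⥤q Q'.V) (g : Q.Arr → Q'.Arr)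
    (hg : ∀ (i j : Q.V) (e : i ⟶ j), (F.map e).1 = g e.1) (hF : Function.Injective F.obj) :
    QRep Q E where
  ε i := R.ε (F.obj i)
  α e := R.α (g e)
  idem i := R.idem _
  orth i j h := R.orth _ _ fun h' => h (hF h')
  tα e := by
    have h := (F.map (⟨e, rfl, rfl⟩ : Q.s e ⟶ Q.t e)).2.2
    rw [hg] at h
    rw [← h]
    exact R.tα _
  αs e := by
    have h := (F.map (⟨e, rfl, rfl⟩ : Q.s e ⟶ Q.t e)).2.1
    rw [hg] at h
    rw [← h]
    exact R.αs _

theorem QRep.pull_onPath (R : QRep Q' E) (F : Q.V ⥤q Q'.V) (g : Q.Arr → Q'.Arr)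
    (hg : ∀ (i j : Q.V) (e : i ⟶ j), (F.map e).1 = g e.1) (hF : Function.Injective F.obj)
    {i j : Q.V} (p : Quiver.Path i j) :
    (R.pull F g hg hF).onPath p = R.onPath (F.mapPath p) := by
  induction p with
  | nil => rfl
  | cons p e ih =>
    rw [QRep.onPath_cons, ih, Prefunctor.mapPath_cons, QRep.onPath_cons, hg]; rfl

theorem QRep.hom_lift [Algebra K E] (R : QRep Q' E) (F : Q.V ⥤q Q'.V) (g : Q.Arr → Q'.Arr)
    (hg : ∀ (i j : Q.V) (e : i ⟶ j), (F.map e).1 = g e.1) (hF : Function.Injective F.obj)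
    (r : PIdx Q →₀ K) :
    R.hom K (evalPA K Q' (Finsupp.mapDomain (fun q : PIdx Q =>
      (⟨F.obj q.1, F.obj q.2.1, F.mapPath q.2.2⟩ : PIdx Q')) r)) =
    (R.pull F g hg hF).hom K (evalPA K Q r) := by
  rw [QRep.hom_evalPA, QRep.hom_evalPA]
  refine (Finsupp.sum_mapDomain_index (f := fun q : PIdx Q =>
      (⟨F.obj q.1, F.obj q.2.1, F.mapPath q.2.2⟩ : PIdx Q'))
      (h := fun (q : PIdx Q') (k : K) => k • R.onPath q.2.2)
      (fun q => zero_smul _ _) (fun q k l => add_smul _ _ _)).trans ?_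
  refine Finset.sum_congr rfl fun q _ => ?_
  exact congrArg (fun z => r q • z) (QRep.pull_onPath R F g hg hF q.2.2).symm

/-- The representation underlying a homomorphism from the bound quiver algebra. -/
noncomputable def repOf [Algebra K E] {I : TwoSidedIdeal (PathAlg K Q)}
    (φ : BQAlg K Q I →ₙₐ[K] E) : QRep Q E where
  ε i := φ (bv I i)
  α e := φ (ba I e)
  idem i := by rw [← map_mul, bv_idem]
  orth i j h := by rw [← map_mul, bv_orth _ _ h, map_zero]
  tα e := by rw [← map_mul, bv_ba]
  αs e := by rw [← map_mul, ba_bv]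

theorem repOf_onPath [Algebra K E] {I : TwoSidedIdeal (PathAlg K Q)}
    (φ : BQAlg K Q I →ₙₐ[K] E) {i j : Q.V} (p : Quiver.Path i j) :
    (repOf φ).onPath p = φ (bp I p) := by
  induction p with
  | nil => rfl
  | cons p e ih => rw [QRep.onPath_cons, ih, bp_cons, map_mul]; rfl

theorem repOf_hom [Algebra K E] {I : TwoSidedIdeal (PathAlg K Q)}
    (φ : BQAlg K Q I →ₙₐ[K] E) (x : PathAlg K Q) :
    (repOf φ).hom K x = φ (BQmk K Q I x) := by
  induction x using pa_induction with
  | h0 => rw [map_zero, map_zero, map_zero]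
  | hp i j p => rw [QRep.hom_path, repOf_onPath]; rfl
  | hadd x y hx hy => rw [map_add, hx, hy, map_add, map_add]
  | hsmul k x hx => rw [map_smul, hx, BQmk_smul, map_smul]

theorem QRep.ext_of {R S : QRep Q E} (h1 : R.ε = S.ε) (h2 : R.α = S.α) : R = S := by
  cases R; cases S; cases h1; cases h2; rfl

theorem bq_hom_ext [Algebra K E] {I : TwoSidedIdeal (PathAlg K Q)}
    {φ ψ : BQAlg K Q I →ₙₐ[K] E} (h1 : ∀ i, φ (bv I i) = ψ (bv I i))
    (h2 : ∀ e, φ (ba I e) = ψ (ba I e)) (x : BQAlg K Q I) : φ x = ψ x := by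
  have h : repOf φ = repOf ψ := QRep.ext_of (funext h1) (funext h2)
  obtain ⟨y, rfl⟩ := BQmk_surj I x
  rw [← repOf_hom, h, repOf_hom]

end Pull

section FinAbs

variable {K A B L : Type} [Field K] [Ring A] [Algebra K A] [Ring B] [Algebra K B]
    [Ring L] [Algebra K L]

theorem glue_fin [FiniteDimensional K A] [FiniteDimensional K B] (ea : A) (eb : B)
    (iA : A →ₙₐ[K] L) (iB : B →ₙₐ[K] L) (rel : GlueRel ea eb iA iB)
    (gen : Algebra.adjoin K (Set.range iA ∪ Set.range iB) = ⊤) (χ : A → K)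
    (hχ : ∀ x, ea * x * ea = χ x • ea) : FiniteDimensional K L := by
  obtain ⟨r1, r2, r3, r4⟩ := rel
  let SA : Submodule K L := LinearMap.range (iA : A →ₗ[K] L)
  let SB : Submodule K L := LinearMap.range (iB : B →ₗ[K] L)
  have fA : SA.FG := Module.Finite.iff_fg.mp inferInstance
  have fB : SB.FG := Module.Finite.iff_fg.mp inferInstance
  have mA : ∀ x, iA x ∈ SA := fun x => ⟨x, rfl⟩
  have mB : ∀ x, iB x ∈ SB := fun x => ⟨x, rfl⟩
  have hAA : SA * SA ≤ SA := by
    rw [Submodule.mul_le]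
    rintro _ ⟨x, rfl⟩ _ ⟨y, rfl⟩
    exact ⟨x * y, map_mul iA x y⟩
  have hBB : SB * SB ≤ SB := by
    rw [Submodule.mul_le]
    rintro _ ⟨x, rfl⟩ _ ⟨y, rfl⟩
    exact ⟨x * y, map_mul iB x y⟩
  have key : ∀ y x y', iB y * (iA x * iB y') = χ x • iB (y * eb * y') := by
    intro y x y'
    have e1 : iB y = iB y * iB 1 := by rw [← map_mul, mul_one]
    have e2 : iB y' = iB 1 * iB y' := by rw [← map_mul, one_mul]
    have e3 : iA x = iA 1 * iA x * iA 1 := by rw [← map_mul, ← map_mul, one_mul, mul_one]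
    have e4 : iB 1 * iA x * iB 1 = χ x • iB eb := by
      calc iB 1 * iA x * iB 1 = (iB 1 * iA 1) * iA x * (iA 1 * iB 1) := by
            rw [e3]; simp only [mul_assoc]
            congr 1
            simp only [← mul_assoc, ← map_mul, mul_one, one_mul]
        _ = iA (ea * x * ea) := by rw [r2, r3, ← map_mul, ← map_mul]
        _ = χ x • iB eb := by rw [hχ, map_smul, r1]
    calc iB y * (iA x * iB y') = iB y * (iB 1 * iA x * iB 1) * iB y' := by
          conv_lhs => rw [e1, e2]
          simp only [mul_assoc]
      _ = χ x • iB (y * eb * y') := by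
          rw [e4, mul_smul_comm, smul_mul_assoc, map_mul, map_mul]
  have hBAB : SB * (SA * SB) ≤ SB := by
    rw [Submodule.mul_le]
    rintro _ ⟨y, rfl⟩ z hz
    induction hz using Submodule.mul_induction_on' with
    | mem_mul_mem m hm n hn =>
      obtain ⟨x, rfl⟩ := hm
      obtain ⟨y', rfl⟩ := hn
      change iB y * (iA x * iB y') ∈ _
      rw [key]
      exact Submodule.smul_mem _ _ (mB _)
    | add x hx y hy h1 h2 => rw [mul_add]; exact Submodule.add_mem _ h1 h2
  let S : Submodule K L := SA * (SB * SA) ⊔ (SB * SA ⊔ (SA * SB ⊔ (SA ⊔ SB)))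
  have s1 : SA * (SB * SA) ≤ S := le_sup_left
  have s2 : SB * SA ≤ S := le_sup_left.trans le_sup_right
  have s3 : SA * SB ≤ S := (le_sup_left.trans le_sup_right).trans le_sup_right
  have s4 : SA ≤ S := ((le_sup_left.trans le_sup_right).trans le_sup_right).trans le_sup_right
  have s5 : SB ≤ S := ((le_sup_right.trans le_sup_right).trans le_sup_right).trans le_sup_right
  have hA : SA * S ≤ S := by
    simp only [S, Submodule.mul_sup]
    refine sup_le ?_ (sup_le ?_ (sup_le ?_ (sup_le ?_ ?_)))
    · rw [← mul_assoc]
      exact (mul_le_mul_left hAA _).trans s1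
    · exact s1
    · rw [← mul_assoc]
      exact (mul_le_mul_left hAA _).trans s3
    · exact hAA.trans s4
    · exact s3
  have hB : SB * S ≤ S := by
    simp only [S, Submodule.mul_sup]
    refine sup_le ?_ (sup_le ?_ (sup_le ?_ (sup_le ?_ ?_)))
    · rw [← mul_assoc, ← mul_assoc, mul_assoc SB]
      exact (mul_le_mul_left hBAB _).trans s2
    · rw [← mul_assoc]
      exact (mul_le_mul_left hBB _).trans s2
    · exact hBAB.trans s5
    · exact s2
    · exact hBB.trans s5
  have h1 : (1 : L) ∈ S := by
    have : (1 : L) = iA 1 + iB 1 - iA ea := by rw [r4, add_sub_cancel_right]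
    rw [this]
    exact Submodule.sub_mem _ (Submodule.add_mem _ (s4 (mA _)) (s5 (mB _))) (s4 (mA _))
  have hall : ∀ x : L, ∀ y ∈ S, x * y ∈ S := by
    intro x
    have hx : x ∈ Algebra.adjoin K (Set.range iA ∪ Set.range iB) := by rw [gen]; trivial
    induction hx using Algebra.adjoin_induction with
    | mem x hx =>
      intro y hy
      rcases hx with ⟨z, rfl⟩ | ⟨z, rfl⟩
      · exact hA (Submodule.mul_mem_mul (mA z) hy)
      · exact hB (Submodule.mul_mem_mul (mB z) hy)
    | algebraMap r =>
      intro y hy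
      rw [← Algebra.smul_def]
      exact Submodule.smul_mem _ _ hy
    | add x y hx hy h1 h2 =>
      intro z hz
      rw [add_mul]
      exact Submodule.add_mem _ (h1 z hz) (h2 z hz)
    | mul x y hx hy h1 h2 =>
      intro z hz
      rw [mul_assoc]
      exact h1 _ (h2 z hz)
  have htop : S = ⊤ := by
    rw [eq_top_iff]
    intro x _
    have := hall x 1 h1
    rwa [mul_one] at this
  have hfg : S.FG := (fA.mul (fB.mul fA)).sup ((fB.mul fA).sup ((fA.mul fB).sup (fA.sup fB)))
  rw [htop] at hfg
  exact ⟨hfg⟩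

end FinAbs

open CategoryTheory

section Concrete

variable {QA QB : BQuiver} {a : QA.V} {b : QB.V} {K : Type} [Field K]

theorem vmapB_self : vmapB QA QB a b b = Sum.inl a := dif_pos rfl

theorem vmapB_ne (x : {x : QB.V // x ≠ b}) : vmapB QA QB a b x.1 = Sum.inr x := dif_neg x.2

theorem vmapB_inj : Function.Injective (vmapB QA QB a b) := by
  intro x y h
  by_cases hx : x = b
  · by_cases hy : y = b
    · rw [hx, hy]
    · have h1 := vmapB_ne (QA := QA) (a := a) ⟨y, hy⟩
      rw [hx, vmapB_self] at h
      exact absurd (h.trans h1) (by simp)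
  · have h0 := vmapB_ne (QA := QA) (a := a) ⟨x, hx⟩
    by_cases hy : y = b
    · rw [hy, vmapB_self] at h
      exact absurd (h0.symm.trans h) (by simp)
    · have h1 := vmapB_ne (QA := QA) (a := a) ⟨y, hy⟩
      have := (h0.symm.trans h).trans h1
      exact congrArg Subtype.val (Sum.inr.inj this)

theorem embA_map (i j : QA.V) (e : i ⟶ j) : ((embA QA QB a b).map e).1 = Sum.inl e.1 := rfl

theorem embB_map (i j : QB.V) (e : i ⟶ j) : ((embB QA QB a b).map e).1 = Sum.inr e.1 := rfl

theorem embA_inj : Function.Injective (embA QA QB a b).obj := Sum.inl_injective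

theorem embB_inj : Function.Injective (embB QA QB a b).obj := vmapB_inj

variable {E : Type} [Ring E]

/-- Restriction of a representation of the glued quiver to the first quiver. -/
def resA (R : QRep (glueQ QA QB a b) E) : QRep QA E :=
  R.pull (embA QA QB a b) Sum.inl embA_map embA_inj

/-- Restriction of a representation of the glued quiver to the second quiver. -/
def resB (R : QRep (glueQ QA QB a b) E) : QRep QB E :=
  R.pull (embB QA QB a b) Sum.inr embB_map embB_inj

theorem resA_hom [Algebra K E] (R : QRep (glueQ QA QB a b) E) (r : PIdx QA →₀ K) :
    R.hom K (evalPA K _ (liftA QA QB a b K r)) = (resA R).hom K (evalPA K QA r) :=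
  QRep.hom_lift R (embA QA QB a b) Sum.inl embA_map embA_inj r

theorem resB_hom [Algebra K E] (R : QRep (glueQ QA QB a b) E) (r : PIdx QB →₀ K) :
    R.hom K (evalPA K _ (liftB QA QB a b K r)) = (resB R).hom K (evalPA K QB r) :=
  QRep.hom_lift R (embB QA QB a b) Sum.inr embB_map embB_inj r

variable (QA QB a b K) (RA : Set (PIdx QA →₀ K)) (RB : Set (PIdx QB →₀ K))

/-- The tautological representation of the glued quiver. -/
noncomputable def repL : QRep (glueQ QA QB a b) (LRing QA QB a b K RA RB) :=
  repOf (NonUnitalAlgHom.id K (LRing QA QB a b K RA RB))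

theorem repL_hom (x : PathAlg K (glueQ QA QB a b)) :
    (repL QA QB a b K RA RB).hom K x = BQmk K _ _ x := repOf_hom _ x

theorem resA_kills : ∀ x ∈ relIdeal K QA RA, (resA (repL QA QB a b K RA RB)).hom K x = 0 := by
  apply kills
  intro r hr
  rw [← resA_hom, repL_hom, BQmk_eq_zero]
  exact TwoSidedIdeal.subset_span ⟨_, Or.inl ⟨r, hr, rfl⟩, rfl⟩

theorem resB_kills : ∀ x ∈ relIdeal K QB RB, (resB (repL QA QB a b K RA RB)).hom K x = 0 := by
  apply kills
  intro r hr
  rw [← resB_hom, repL_hom, BQmk_eq_zero]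
  exact TwoSidedIdeal.subset_span ⟨_, Or.inr ⟨r, hr, rfl⟩, rfl⟩

/-- The map from the first algebra to the gluing algebra. -/
noncomputable def incA : ARing QA K RA →ₙₐ[K] LRing QA QB a b K RA RB :=
  BQlift _ (resA_kills QA QB a b K RA RB)

/-- The map from the second algebra to the gluing algebra. -/
noncomputable def incB : ARing QB K RB →ₙₐ[K] LRing QA QB a b K RA RB :=
  BQlift _ (resB_kills QA QB a b K RA RB)

theorem incA_bp {i j : QA.V} (p : Quiver.Path i j) : incA QA QB a b K RA RB (bp _ p) =
    (resA (repL QA QB a b K RA RB)).onPath p :=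
  (BQlift_mk _ (resA_kills QA QB a b K RA RB) _).trans (QRep.hom_path _ p)

theorem incB_bp {i j : QB.V} (p : Quiver.Path i j) : incB QA QB a b K RA RB (bp _ p) =
    (resB (repL QA QB a b K RA RB)).onPath p :=
  (BQlift_mk _ (resB_kills QA QB a b K RA RB) _).trans (QRep.hom_path _ p)

theorem incA_bv (i : QA.V) : incA QA QB a b K RA RB (bv _ i) =
    bv (Q := glueQ QA QB a b) (glueIdeal QA QB a b K RA RB) (Sum.inl i) := incA_bp _ _ _ _ _ _ _ _

theorem incB_bv (i : QB.V) : incB QA QB a b K RA RB (bv _ i) =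
    bv (Q := glueQ QA QB a b) (glueIdeal QA QB a b K RA RB) (vmapB QA QB a b i) :=
  incB_bp _ _ _ _ _ _ _ _

theorem incA_ba (e : QA.Arr) : incA QA QB a b K RA RB (ba _ e) =
    ba (Q := glueQ QA QB a b) (glueIdeal QA QB a b K RA RB) (Sum.inl e) := by
  refine (incA_bp _ _ _ _ _ _ _ _).trans ?_
  refine (QRep.onPath_cons _ _ _).trans ?_
  exact ba_bv (Q := glueQ QA QB a b) (I := glueIdeal QA QB a b K RA RB) (Sum.inl e)

theorem incB_ba (e : QB.Arr) : incB QA QB a b K RA RB (ba _ e) =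
    ba (Q := glueQ QA QB a b) (glueIdeal QA QB a b K RA RB) (Sum.inr e) := by
  refine (incB_bp _ _ _ _ _ _ _ _).trans ?_
  refine (QRep.onPath_cons _ _ _).trans ?_
  exact ba_bv (Q := glueQ QA QB a b) (I := glueIdeal QA QB a b K RA RB) (Sum.inr e)

theorem incA_one : incA QA QB a b K RA RB 1 = ∑ i : QA.V,
    bv (Q := glueQ QA QB a b) (glueIdeal QA QB a b K RA RB) (Sum.inl i) := by
  rw [← bv_sum, map_sum]
  exact Finset.sum_congr rfl fun i _ => incA_bv _ _ _ _ _ _ _ i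

theorem sum_ne_b {M : Type} [AddCommGroup M] (f : QB.V → M) :
    ∑ j, f j = f b + ∑ j : {x : QB.V // x ≠ b}, f j.1 := by
  exact Fintype.sum_eq_add_sum_subtype_ne f b

theorem incB_one : incB QA QB a b K RA RB 1 =
    bv (Q := glueQ QA QB a b) (glueIdeal QA QB a b K RA RB) (Sum.inl a) +
    ∑ j : {x : QB.V // x ≠ b},
    bv (Q := glueQ QA QB a b) (glueIdeal QA QB a b K RA RB) (Sum.inr j) := by
  rw [← bv_sum, map_sum, sum_ne_b QB b]
  congr 1
  · rw [incB_bv, vmapB_self]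
  · exact Finset.sum_congr rfl fun i _ => by rw [incB_bv, vmapB_ne]

theorem sum_glueV {M : Type} [AddCommGroup M] (f : (glueQ QA QB a b).V → M) :
    ∑ v, f v = ∑ i : QA.V, f (Sum.inl i) + ∑ j : {x : QB.V // x ≠ b}, f (Sum.inr j) :=
  Fintype.sum_sum_type (α₁ := QA.V) (α₂ := {x : QB.V // x ≠ b}) f

theorem inc_rel : GlueRel (bv (relIdeal K QA RA) a) (bv (relIdeal K QB RB) b)
    (incA QA QB a b K RA RB) (incB QA QB a b K RA RB) := by
  have o1 : ∀ i j, bv (Q := glueQ QA QB a b) (glueIdeal QA QB a b K RA RB) (Sum.inl i) *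
      bv (Q := glueQ QA QB a b) (glueIdeal QA QB a b K RA RB) (Sum.inr j) = 0 :=
    fun i j => bv_orth _ _ Sum.inl_ne_inr
  have o2 : ∀ i j, bv (Q := glueQ QA QB a b) (glueIdeal QA QB a b K RA RB) (Sum.inr j) *
      bv (Q := glueQ QA QB a b) (glueIdeal QA QB a b K RA RB) (Sum.inl i) = 0 :=
    fun i j => bv_orth _ _ Sum.inr_ne_inl
  have d1 : incA QA QB a b K RA RB 1 *
      bv (Q := glueQ QA QB a b) (glueIdeal QA QB a b K RA RB) (Sum.inl a) =
      bv (Q := glueQ QA QB a b) (glueIdeal QA QB a b K RA RB) (Sum.inl a) := by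
    rw [← incA_bv, ← map_mul, one_mul]
  have d2 : bv (Q := glueQ QA QB a b) (glueIdeal QA QB a b K RA RB) (Sum.inl a) *
      incA QA QB a b K RA RB 1 =
      bv (Q := glueQ QA QB a b) (glueIdeal QA QB a b K RA RB) (Sum.inl a) := by
    rw [← incA_bv, ← map_mul, mul_one]
  refine ⟨?_, ?_, ?_, ?_⟩
  · rw [incA_bv, incB_bv, vmapB_self]
  · rw [incB_one, mul_add, d1, incA_bv, incA_one, Finset.sum_mul_sum]
    simp only [o1, Finset.sum_const_zero, add_zero]
  · rw [incB_one, add_mul, d2, incA_bv, incA_one, Finset.sum_mul_sum]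
    simp only [o2, Finset.sum_const_zero, add_zero]
  · rw [incA_one, incB_one, incA_bv, ← bv_sum, sum_glueV]
    abel

theorem inc_gen : Algebra.adjoin K (Set.range (incA QA QB a b K RA RB) ∪
    Set.range (incB QA QB a b K RA RB)) = ⊤ := by
  rw [eq_top_iff]
  intro x _
  have hv : ∀ v : (glueQ QA QB a b).V, bv (glueIdeal QA QB a b K RA RB) v ∈
      Algebra.adjoin K (Set.range (incA QA QB a b K RA RB) ∪
        Set.range (incB QA QB a b K RA RB)) := by
    rintro (i | j)
    · exact Algebra.subset_adjoin (Or.inl ⟨_, incA_bv QA QB a b K RA RB i⟩)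
    · refine Algebra.subset_adjoin (Or.inr ⟨_, (incB_bv QA QB a b K RA RB j.1).trans ?_⟩)
      rw [vmapB_ne]
  have ha : ∀ v : (glueQ QA QB a b).Arr, ba (glueIdeal QA QB a b K RA RB) v ∈
      Algebra.adjoin K (Set.range (incA QA QB a b K RA RB) ∪
        Set.range (incB QA QB a b K RA RB)) := by
    rintro (i | j)
    · exact Algebra.subset_adjoin (Or.inl ⟨_, incA_ba QA QB a b K RA RB i⟩)
    · exact Algebra.subset_adjoin (Or.inr ⟨_, incB_ba QA QB a b K RA RB j⟩)
  induction x using bq_induction with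
  | h0 => exact Subalgebra.zero_mem _
  | hadd x y hx hy => exact Subalgebra.add_mem _ (hx trivial) (hy trivial)
  | hsmul k x hx => exact Subalgebra.smul_mem _ (hx trivial) k
  | hp i j p =>
    induction p with
    | nil => exact hv _
    | cons p e ih => rw [bp_cons]; exact Subalgebra.mul_mem _ (ha _) (ih trivial)

variable {QA QB a b K RA RB}

/-- The representation of the glued quiver determined by a compatible pair. -/
noncomputable def repGlue [Algebra K E] (φA : ARing QA K RA →ₙₐ[K] E) (φB : ARing QB K RB →ₙₐ[K] E)
    (h : GlueRel (bv (relIdeal K QA RA) a) (bv (relIdeal K QB RB) b) φA φB) :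
    QRep (glueQ QA QB a b) E :=
  have hv : ∀ j, (Sum.elim (fun i => φA (bv _ i)) (fun j => φB (bv _ j.1)) :
      QA.V ⊕ {x : QB.V // x ≠ b} → E) (vmapB QA QB a b j) = φB (bv _ j) := by
    intro j
    by_cases hj : j = b
    · subst hj
      rw [vmapB_self]; exact h.1
    · rw [vmapB_ne ⟨j, hj⟩]; rfl
  { ε := Sum.elim (fun i => φA (bv _ i)) (fun j => φB (bv _ j.1))
    α := Sum.elim (fun e => φA (ba _ e)) (fun e => φB (ba _ e))
    idem := by
      rintro (i | i)
      · exact (repOf φA).idem i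
      · exact (repOf φB).idem i.1
    orth := by
      rintro (i | i) (j | j) hij
      · exact (repOf φA).orth i j fun e => hij (congrArg Sum.inl e)
      · change φA (bv _ i) * φB (bv _ j.1) = 0
        rw [← mul_one (bv _ i), ← one_mul (bv _ j.1), map_mul, map_mul, mul_assoc,
          ← mul_assoc (φA 1), h.2.1, h.1, ← map_mul, bv_orth _ _ (Ne.symm j.2), map_zero, mul_zero]
      · change φB (bv _ i.1) * φA (bv _ j) = 0
        rw [← mul_one (bv _ i.1), ← one_mul (bv _ j), map_mul, map_mul, mul_assoc,
          ← mul_assoc (φB 1), h.2.2.1, ← mul_assoc, h.1, ← map_mul, bv_orth _ _ i.2, map_zero,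
          zero_mul]
      · exact (repOf φB).orth i.1 j.1 fun e => hij (congrArg Sum.inr (Subtype.ext e))
    tα := by
      rintro (e | e)
      · exact (repOf φA).tα e
      · refine Eq.trans ?_ ((repOf φB).tα e)
        exact congrArg (fun z => z * φB (ba _ e)) (hv (QB.t e))
    αs := by
      rintro (e | e)
      · exact (repOf φA).αs e
      · refine Eq.trans ?_ ((repOf φB).αs e)
        exact congrArg (fun z => φB (ba _ e) * z) (hv (QB.s e)) }

theorem repGlue_resA [Algebra K E] (φA : ARing QA K RA →ₙₐ[K] E) (φB : ARing QB K RB →ₙₐ[K] E)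
    (h : GlueRel (bv (relIdeal K QA RA) a) (bv (relIdeal K QB RB) b) φA φB) :
    resA (repGlue φA φB h) = repOf φA := QRep.ext_of rfl rfl

theorem repGlue_resB [Algebra K E] (φA : ARing QA K RA →ₙₐ[K] E) (φB : ARing QB K RB →ₙₐ[K] E)
    (h : GlueRel (bv (relIdeal K QA RA) a) (bv (relIdeal K QB RB) b) φA φB) :
    resB (repGlue φA φB h) = repOf φB := by
  refine QRep.ext_of (funext fun j => ?_) rfl
  change (repGlue φA φB h).ε (vmapB QA QB a b j) = φB (bv _ j)
  by_cases hj : j = b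
  · subst hj
    rw [vmapB_self]; exact h.1
  · rw [vmapB_ne ⟨j, hj⟩]; rfl

theorem inc_lift (E : Type) [Ring E] [Algebra K E] (φA : ARing QA K RA →ₙₐ[K] E)
    (φB : ARing QB K RB →ₙₐ[K] E)
    (h : GlueRel (bv (relIdeal K QA RA) a) (bv (relIdeal K QB RB) b) φA φB) :
    ∃ Φ : LRing QA QB a b K RA RB →ₐ[K] E, (∀ x, Φ (incA QA QB a b K RA RB x) = φA x) ∧
      (∀ y, Φ (incB QA QB a b K RA RB y) = φB y) := by
  have hk : ∀ x ∈ glueIdeal QA QB a b K RA RB, (repGlue φA φB h).hom K x = 0 := by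
    apply kills
    rintro _ (⟨r, hr, rfl⟩ | ⟨r, hr, rfl⟩)
    · rw [resA_hom, repGlue_resA, repOf_hom]
      have h0 : BQmk K QA (relIdeal K QA RA) (evalPA K QA r) = 0 :=
        (BQmk_eq_zero _ _).mpr (TwoSidedIdeal.subset_span ⟨r, hr, rfl⟩)
      rw [h0, map_zero]
    · rw [resB_hom, repGlue_resB, repOf_hom]
      have h0 : BQmk K QB (relIdeal K QB RB) (evalPA K QB r) = 0 :=
        (BQmk_eq_zero _ _).mpr (TwoSidedIdeal.subset_span ⟨r, hr, rfl⟩)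
      rw [h0, map_zero]
  let Ψ : LRing QA QB a b K RA RB →ₙₐ[K] E := BQlift _ hk
  have hbp : ∀ {i j : (glueQ QA QB a b).V} (p : Quiver.Path i j),
      Ψ (bp _ p) = (repGlue φA φB h).onPath p := fun p =>
    (BQlift_mk _ hk _).trans (QRep.hom_path _ p)
  have hbv : ∀ v : (glueQ QA QB a b).V, Ψ (bv _ v) = (repGlue φA φB h).ε v := fun v => hbp _
  have hba : ∀ v : (glueQ QA QB a b).Arr, Ψ (ba _ v) = (repGlue φA φB h).α v := fun v =>
    (hbp _).trans ((repGlue φA φB h).αs v)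
  have hA : ∀ x, Ψ (incA QA QB a b K RA RB x) = φA x := by
    intro x
    refine bq_hom_ext (φ := Ψ.comp (incA QA QB a b K RA RB)) (ψ := φA) ?_ ?_ x
    · intro i
      rw [NonUnitalAlgHom.comp_apply, incA_bv]
      exact hbv (Sum.inl i)
    · intro i
      rw [NonUnitalAlgHom.comp_apply, incA_ba]
      exact hba (Sum.inl i)
  have hB : ∀ x, Ψ (incB QA QB a b K RA RB x) = φB x := by
    intro x
    refine bq_hom_ext (φ := Ψ.comp (incB QA QB a b K RA RB)) (ψ := φB) ?_ ?_ x
    · intro i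
      rw [NonUnitalAlgHom.comp_apply, incB_bv]
      refine (hbv (vmapB QA QB a b i)).trans ?_
      exact congrFun (congrArg QRep.ε (repGlue_resB φA φB h)) i
    · intro i
      rw [NonUnitalAlgHom.comp_apply, incB_ba]
      exact hba (Sum.inr i)
  have h1 : Ψ 1 = 1 := by
    have e : (1 : LRing QA QB a b K RA RB) = incA QA QB a b K RA RB 1 + incB QA QB a b K RA RB 1 -
        incA QA QB a b K RA RB (bv _ a) := by
      rw [(inc_rel QA QB a b K RA RB).2.2.2, add_sub_cancel_right]
    rw [e, map_sub, map_add, hA, hA, hB, h.2.2.2, add_sub_cancel_right]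
  exact ⟨{ Ψ with
    map_one' := h1
    commutes' := fun k => by
      rw [Algebra.algebraMap_eq_smul_one, Algebra.algebraMap_eq_smul_one]
      change Ψ (k • 1) = _
      rw [map_smul, h1] }, hA, hB⟩

/-- The concrete gluing algebra satisfies the abstract characterization. -/
noncomputable def mkGlueRing (K : Type) [Field K] (G : GlueData K) :
    GlueRing K (ARing G.QA K G.RA) (ARing G.QB K G.RB) (LRing G.QA G.QB G.a G.b K G.RA G.RB) where
  ea := bv _ G.a
  eb := bv _ G.b
  ida := bv_idem _
  idb := bv_idem _
  iA := incA G.QA G.QB G.a G.b K G.RA G.RB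
  iB := incB G.QA G.QB G.a G.b K G.RA G.RB
  rel := inc_rel G.QA G.QB G.a G.b K G.RA G.RB
  gen := inc_gen G.QA G.QB G.a G.b K G.RA G.RB
  lift := fun E _ _ φA φB h => inc_lift E φA φB h
  χA := chi G.a _ G.admA
  χB := chi G.b _ G.admB
  χea := chi_bv _ _ _
  χeb := chi_bv _ _ _
  fin :=
    have := bq_fin G.fdA
    have := bq_fin G.fdB
    glue_fin _ _ _ _ (inc_rel G.QA G.QB G.a G.b K G.RA G.RB)
      (inc_gen G.QA G.QB G.a G.b K G.RA G.RB) (chi G.a _ G.admA)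
      (corner_scalar G.a _ G.admA G.cyclesA)

end Concrete

/-- Let `Λ` be a simple gluing algebra of the finite-dimensional bound quiver algebras
`A` and `B`.  Then `Λ` is Iwanaga-Gorenstein if and only if `A` and `B` are, and in that case
`max{Gd A, Gd B} ≤ Gd Λ ≤ max{Gd A, Gd B, 1}`. -/
theorem glueAlgebra_iwanagaGorenstein_iff
    (K : Type) [Field K] (G : GlueData K) :
    (IwanagaGorenstein (LRing G.QA G.QB G.a G.b K G.RA G.RB) ↔
      (IwanagaGorenstein (ARing G.QA K G.RA) ∧ IwanagaGorenstein (ARing G.QB K G.RB))) ∧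
    (IwanagaGorenstein (LRing G.QA G.QB G.a G.b K G.RA G.RB) →
      max (gorensteinDim (ARing G.QA K G.RA)) (gorensteinDim (ARing G.QB K G.RB)) ≤
          gorensteinDim (LRing G.QA G.QB G.a G.b K G.RA G.RB) ∧
        gorensteinDim (LRing G.QA G.QB G.a G.b K G.RA G.RB) ≤
          max (max (gorensteinDim (ARing G.QA K G.RA)) (gorensteinDim (ARing G.QB K G.RB)))
            1) := by
  exact (mkGlueRing K G).final
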